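/- If κ is a measurable cardinal, then LD^unf_κ holds: there is a partial function ℓ : κ ⇀ V_κ such that for every ordinal θ, every set A ∈ H(κ⁺), and every transitive set M of size κ with M^{<κ} ⊆ M and ℓ, A ∈ M, there is a θ-unfoldability embedding j : M → N with j(ℓ)(κ) = A. -/

import Mathlib

open FirstOrder

universe u

namespace LaverDiamond

/-- The relation symbols of the language of set theory: a single binary relation `mem`. -/
inductive memRel : ℕ → Type
  | mem : memRel 2

/-- The first-order language of set theory. -/
def SetLang : FirstOrder.Language := ⟨fun _ => Empty, memRel⟩

/-- Any class of ZF-sets is a structure in the language of set theory, with the true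
membership relation. -/
instance classStructure (M : Set ZFSet.{u}) : SetLang.Structure M where
  funMap := fun {_} f _ => f.elim
  RelMap := fun {_} r x => match r with
    | .mem => (x 0 : ZFSet) ∈ (x 1 : ZFSet)

/-- A (fully) elementary embedding from the class `M` to the class `N`, both classes of
ZF-sets equipped with the true membership relation.  It is coded by a global function
`j : ZFSet → ZFSet` mapping `M` into `N`, elementary for all first-order formulas
with parameters from `M`. -/
structure ClassEmb (M N : Set ZFSet.{u}) where
  j : ZFSet.{u} → ZFSet.{u}
  maps : ∀ x, x ∈ M → j x ∈ N
  elem : ∀ {n : ℕ} (φ : SetLang.Formula (Fin n)) (v : Fin n → ZFSet.{u}) (hv : ∀ i, v i ∈ M),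
    φ.Realize (fun i => (⟨v i, hv i⟩ : M)) ↔ φ.Realize (fun i => (⟨j (v i), maps _ (hv i)⟩ : N))

/-- The universe of all ZF-sets, as a class. -/
def V : Set ZFSet.{u} := Set.univ

/-- A transitive class of ZF-sets. -/
def TransClass (M : Set ZFSet.{u}) : Prop := ∀ x ∈ M, ∀ y ∈ x, y ∈ M

/-- `j` has critical point `κ`: `κ` is an ordinal, fixed below `κ`, with `j(κ) > κ`. -/
def CritPt (j : ZFSet.{u} → ZFSet.{u}) (κ : ZFSet.{u}) : Prop :=
  κ.IsOrdinal ∧ κ ∈ j κ ∧ ∀ α : ZFSet, α.IsOrdinal → α ∈ κ → j α = α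

/-- `x` is a member of the rank-initial segment `V_θ`. -/
def MemV (θ x : ZFSet.{u}) : Prop := x.rank < θ.rank

/-- `κ` is a cardinal: an ordinal not equinumerous with any smaller ordinal. -/
def IsCard (κ : ZFSet.{u}) : Prop :=
  κ.IsOrdinal ∧ ∀ β ∈ κ, Cardinal.mk β.toSet < Cardinal.mk κ.toSet

/-- `x ∈ H(θ⁺)`, i.e. `x` has hereditary size at most `θ`. -/
def MemH (θ x : ZFSet.{u}) : Prop :=
  ∃ t : ZFSet, t.IsTransitive ∧ x ∈ t ∧ Cardinal.mk t.toSet ≤ Cardinal.mk θ.toSet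

/-- `f` is a set-function with domain `θ` taking values in the class `M`. -/
def IsFuncInto (θ : ZFSet.{u}) (M : Set ZFSet.{u}) (f : ZFSet.{u}) : Prop :=
  (∀ p ∈ f, ∃ a b : ZFSet, a ∈ θ ∧ b ∈ M ∧ p = ZFSet.pair a b) ∧
  ∀ a ∈ θ, ∃! b : ZFSet, ZFSet.pair a b ∈ f

/-- The class `M` is closed under `θ`-sequences: `M^θ ⊆ M`. -/
def SeqClosed (θ : ZFSet.{u}) (M : Set ZFSet.{u}) : Prop :=
  ∀ f : ZFSet, IsFuncInto θ M f → f ∈ M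

/-- The set `M` is closed under `<κ`-sequences: `M^{<κ} ⊆ M`. -/
def SeqClosedLt (κ M : ZFSet.{u}) : Prop :=
  ∀ α : ZFSet, α ∈ κ → ∀ f : ZFSet, IsFuncInto α M.toSet f → f ∈ M

/-- `ℓ` is a partial function from `κ` to `V_κ` (coded as a set of Kuratowski pairs). -/
def IsPFun (κ ℓ : ZFSet.{u}) : Prop :=
  (∀ p ∈ ℓ, ∃ γ A : ZFSet, γ ∈ κ ∧ MemV κ A ∧ p = ZFSet.pair γ A) ∧
  ∀ γ A B : ZFSet, ZFSet.pair γ A ∈ ℓ → ZFSet.pair γ B ∈ ℓ → A = B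

/-- The set `r` is the restriction to `κ` of the class function `ℓ` (defined on the
ordinals below `κ`), coded as a set of Kuratowski pairs. -/
def RestrictEq (ℓ : ZFSet.{u} → ZFSet.{u}) (κ r : ZFSet.{u}) : Prop :=
  ∀ p : ZFSet, p ∈ r ↔ ∃ γ : ZFSet, γ ∈ κ ∧ p = ZFSet.pair γ (ℓ γ)

/-- The set `r` is the restriction to `κ` of the class function `ℓ` restricted further to
the class `D`. -/
def RestrictEqOn (ℓ : ZFSet.{u} → ZFSet.{u}) (D : Set ZFSet.{u}) (κ r : ZFSet.{u}) : Prop :=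
  ∀ p : ZFSet, p ∈ r ↔ ∃ γ : ZFSet, γ ∈ κ ∧ γ ∈ D ∧ p = ZFSet.pair γ (ℓ γ)

/-- The set `r` is the restriction to `δ` of the set partial function `ℓ`. -/
def RestrictSet (ℓ δ r : ZFSet.{u}) : Prop :=
  ∀ p : ZFSet, p ∈ r ↔ p ∈ ℓ ∧ ∃ γ A : ZFSet, γ ∈ δ ∧ p = ZFSet.pair γ A

/-! ### Supercompactness -/

/-- A `θ`-supercompactness embedding with critical point `κ`: an elementary embedding
`j : V → M` with `M` a transitive class closed under `θ`-sequences and `j(κ) > θ`. -/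
structure SCEmb (κ θ : ZFSet.{u}) where
  M : Set ZFSet.{u}
  trans : TransClass M
  e : ClassEmb V M
  crit : CritPt e.j κ
  closed : SeqClosed θ M
  big : θ ∈ e.j κ

/-- `κ` is `θ`-supercompact. -/
def SCAt (κ θ : ZFSet.{u}) : Prop := Nonempty (SCEmb κ θ)

/-- `κ` is supercompact: `θ`-supercompact for every cardinal `θ`. -/
def Supercompact (κ : ZFSet.{u}) : Prop := ∀ θ : ZFSet, IsCard θ → SCAt κ θ

/-- `ℓ` is a Laver function witnessing the Laver diamond `LD^sc_κ`. -/
def LDscFun (κ ℓ : ZFSet.{u}) : Prop :=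
  IsPFun κ ℓ ∧ ∀ θ A : ZFSet, IsCard θ → MemH θ A →
    ∃ E : SCEmb κ θ, ZFSet.pair κ A ∈ E.e.j ℓ

/-- The Laver diamond principle `LD^sc_κ`. -/
def LDsc (κ : ZFSet.{u}) : Prop := ∃ ℓ : ZFSet, LDscFun κ ℓ

/-- A universal `LD^sc` Laver function. -/
def UnivLDsc (ℓ : ZFSet.{u} → ZFSet.{u}) : Prop :=
  ∀ κ : ZFSet, Supercompact κ → ∃ r : ZFSet, RestrictEq ℓ κ r ∧ LDscFun κ r

/-! ### Strongness -/

/-- A `θ`-strongness embedding with critical point `κ`: an elementary `j : V → M` with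
`M` a transitive class and `V_θ ⊆ M`. -/
structure StrEmb (κ θ : ZFSet.{u}) where
  M : Set ZFSet.{u}
  trans : TransClass M
  e : ClassEmb V M
  crit : CritPt e.j κ
  vsub : ∀ x : ZFSet, MemV θ x → x ∈ M

/-- `κ` is `θ`-strong. -/
def StrongAt (κ θ : ZFSet.{u}) : Prop := Nonempty (StrEmb κ θ)

/-- `κ` is a strong cardinal. -/
def Strong (κ : ZFSet.{u}) : Prop := ∀ θ : ZFSet, θ.IsOrdinal → StrongAt κ θ

/-- `ℓ` witnesses the Laver diamond `LD^strong_κ`. -/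
def LDstrongFun (κ ℓ : ZFSet.{u}) : Prop :=
  IsPFun κ ℓ ∧ ∀ θ A : ZFSet, θ.IsOrdinal → MemV θ A →
    ∃ E : StrEmb κ θ, ZFSet.pair κ A ∈ E.e.j ℓ

/-- The Laver diamond principle `LD^strong_κ`. -/
def LDstrong (κ : ZFSet.{u}) : Prop := ∃ ℓ : ZFSet, LDstrongFun κ ℓ

/-- A universal `LD^strong` Laver function. -/
def UnivLDstrong (ℓ : ZFSet.{u} → ZFSet.{u}) : Prop :=
  ∀ κ : ZFSet, Strong κ → ∃ r : ZFSet, RestrictEq ℓ κ r ∧ LDstrongFun κ r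

/-! ### Measurability -/

/-- An embedding witnessing measurability of `κ`: an elementary `j : V → M`
with `M` a transitive class and critical point `κ`. -/
structure MeasEmb (κ : ZFSet.{u}) where
  M : Set ZFSet.{u}
  trans : TransClass M
  e : ClassEmb V M
  crit : CritPt e.j κ

/-- `κ` is a measurable cardinal. -/
def MeasurableCard (κ : ZFSet.{u}) : Prop := Nonempty (MeasEmb κ)

/-- `ℓ` witnesses the Laver diamond `LD^meas_κ`. -/
def LDmeasFun (κ ℓ : ZFSet.{u}) : Prop :=
  IsPFun κ ℓ ∧ ∀ A : ZFSet, MemH κ A → ∃ E : MeasEmb κ, ZFSet.pair κ A ∈ E.e.j ℓ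

/-- The Laver diamond principle `LD^meas_κ`. -/
def LDmeas (κ : ZFSet.{u}) : Prop := ∃ ℓ : ZFSet, LDmeasFun κ ℓ

/-- A universal `LD^meas` Laver function. -/
def UnivLDmeas (ℓ : ZFSet.{u} → ZFSet.{u}) : Prop :=
  ∀ κ : ZFSet, MeasurableCard κ → ∃ r : ZFSet, RestrictEq ℓ κ r ∧ LDmeasFun κ r

/-! ### Weak compactness -/

/-- `κ` is weakly compact: every transitive set `M` of size `κ` with `κ ∈ M` admits an
elementary embedding `j : M → N` into a transitive set `N` with critical point `κ`. -/
def WeaklyCompact (κ : ZFSet.{u}) : Prop :=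
  ∀ M : ZFSet, M.IsTransitive → Cardinal.mk M.toSet = Cardinal.mk κ.toSet → κ ∈ M →
    ∃ N : ZFSet, N.IsTransitive ∧ ∃ e : ClassEmb M.toSet N.toSet, CritPt e.j κ

/-- `ℓ` witnesses the Laver diamond `LD^wc_κ`. -/
def LDwcFun (κ ℓ : ZFSet.{u}) : Prop :=
  IsPFun κ ℓ ∧ ∀ A M : ZFSet, MemH κ A →
    M.IsTransitive → Cardinal.mk M.toSet = Cardinal.mk κ.toSet → κ ∈ M → A ∈ M → ℓ ∈ M →
    ∃ N : ZFSet, N.IsTransitive ∧ ∃ e : ClassEmb M.toSet N.toSet,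
      CritPt e.j κ ∧ ZFSet.pair κ A ∈ e.j ℓ

/-- The Laver diamond principle `LD^wc_κ`. -/
def LDwc (κ : ZFSet.{u}) : Prop := ∃ ℓ : ZFSet, LDwcFun κ ℓ

/-- A universal `LD^wc` Laver function. -/
def UnivLDwc (ℓ : ZFSet.{u} → ZFSet.{u}) : Prop :=
  ∀ κ : ZFSet, WeaklyCompact κ → ∃ r : ZFSet, RestrictEq ℓ κ r ∧ LDwcFun κ r

/-! ### Nice structures and unfoldability -/

/-- `M` is a nice structure for `κ`: a transitive set of size `κ`, closed under
`<κ`-sequences, with `κ ∈ M`. -/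
def Nice (κ M : ZFSet.{u}) : Prop :=
  M.IsTransitive ∧ Cardinal.mk M.toSet = Cardinal.mk κ.toSet ∧ SeqClosedLt κ M ∧ κ ∈ M

/-- `κ` is unfoldable: for every ordinal `θ`, every nice structure admits a
`θ`-unfoldability embedding. -/
def Unfoldable (κ : ZFSet.{u}) : Prop :=
  ∀ θ M : ZFSet, θ.IsOrdinal → Nice κ M →
    ∃ N : ZFSet, N.IsTransitive ∧ ∃ e : ClassEmb M.toSet N.toSet, CritPt e.j κ ∧ θ ∈ e.j κ

/-- `ℓ` witnesses the Laver diamond `LD^unf_κ`. -/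
def LDunfFun (κ ℓ : ZFSet.{u}) : Prop :=
  IsPFun κ ℓ ∧ ∀ θ A M : ZFSet, θ.IsOrdinal → MemH κ A →
    M.IsTransitive → Cardinal.mk M.toSet = Cardinal.mk κ.toSet → SeqClosedLt κ M →
    κ ∈ M → ℓ ∈ M → A ∈ M →
    ∃ N : ZFSet, N.IsTransitive ∧ ∃ e : ClassEmb M.toSet N.toSet,
      CritPt e.j κ ∧ θ ∈ e.j κ ∧ ZFSet.pair κ A ∈ e.j ℓ

/-- The Laver diamond principle `LD^unf_κ`. -/
def LDunf (κ : ZFSet.{u}) : Prop := ∃ ℓ : ZFSet, LDunfFun κ ℓ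

/-- `ℓ` witnesses the Laver diamond `LD^sunf_κ` for strong unfoldability. -/
def LDsunfFun (κ ℓ : ZFSet.{u}) : Prop :=
  IsPFun κ ℓ ∧ ∀ θ A M : ZFSet, IsCard θ → MemH θ A →
    M.IsTransitive → Cardinal.mk M.toSet = Cardinal.mk κ.toSet → SeqClosedLt κ M →
    κ ∈ M → ℓ ∈ M →
    ∃ N : ZFSet, N.IsTransitive ∧ (∀ x : ZFSet, MemV θ x → x ∈ N) ∧
      ∃ e : ClassEmb M.toSet N.toSet, CritPt e.j κ ∧ θ ∈ e.j κ ∧ ZFSet.pair κ A ∈ e.j ℓ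

/-! ### Ramsey cardinals -/

/-- `F` is a weakly amenable `M`-normal measure on `κ`. -/
def MNormalMeasure (κ M F : ZFSet.{u}) : Prop :=
  (∀ X ∈ F, X ⊆ κ ∧ X ∈ M) ∧ κ ∈ F ∧ (∅ : ZFSet) ∉ F ∧
  (∀ X Y : ZFSet, X ∈ F → Y ∈ F → X ∩ Y ∈ F) ∧
  (∀ X Y : ZFSet, X ∈ F → Y ∈ M → X ⊆ Y → Y ⊆ κ → Y ∈ F) ∧
  (∀ X : ZFSet, X ∈ M → X ⊆ κ → (X ∈ F ∨ κ \ X ∈ F)) ∧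
  (∀ ξ ∈ κ, ({ξ} : ZFSet) ∉ F) ∧
  (∀ γ f : ZFSet, γ ∈ κ → f ∈ M → IsFuncInto γ F.toSet f →
    ZFSet.sep (fun ξ => ∀ a X : ZFSet, ZFSet.pair a X ∈ f → ξ ∈ X) κ ∈ F) ∧
  (∀ f : ZFSet, f ∈ M → IsFuncInto κ F.toSet f →
    ZFSet.sep (fun ξ => ∀ a X : ZFSet, ZFSet.pair a X ∈ f → a ∈ ξ → ξ ∈ X) κ ∈ F) ∧
  (∀ D : ZFSet, D ∈ M → MemH κ D → F ∩ D ∈ M)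

/-- `j` is (isomorphic to) the ultrapower map of `M` by the `M`-measure `F` on `κ`, with
transitive (wellfounded) target `N`: `j` is elementary, has critical point `κ`, derives the
measure `F` at `κ`, and every element of `N` has the form `j(f)(κ)` for some function
`f ∈ M` with domain `κ`. -/
def IsUltrapowerMap (κ M F N : ZFSet.{u}) (j : ZFSet.{u} → ZFSet.{u}) : Prop :=
  N.IsTransitive ∧ (∃ e : ClassEmb M.toSet N.toSet, e.j = j) ∧ CritPt j κ ∧
  (∀ X : ZFSet, X ∈ M → X ⊆ κ → (X ∈ F ↔ κ ∈ j X)) ∧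
  (∀ y ∈ N, ∃ f : ZFSet, f ∈ M ∧ (∀ a ∈ κ, ∃! b : ZFSet, ZFSet.pair a b ∈ f) ∧
    ZFSet.pair κ y ∈ j f)

/-- A wellfounded iteration of `⟨M, F⟩` of length `δ`: a commuting system of elementary
embeddings between transitive models, starting at `⟨M, F⟩`, taking ultrapowers by the
image measures at successor steps and direct limits at limit stages. -/
structure Iteration (κ M F δ : ZFSet.{u}) where
  Mod : ZFSet.{u} → ZFSet.{u}
  Meas : ZFSet.{u} → ZFSet.{u}
  cp : ZFSet.{u} → ZFSet.{u}
  emb : ZFSet.{u} → ZFSet.{u} → ZFSet.{u} → ZFSet.{u}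
  mod_zero : Mod ∅ = M
  meas_zero : Meas ∅ = F
  cp_zero : cp ∅ = κ
  trans' : ∀ i : ZFSet, i ∈ δ → (Mod i).IsTransitive
  elem' : ∀ i k : ZFSet, i ∈ δ → k ∈ δ → i ∈ k →
    ∃ e : ClassEmb (Mod i).toSet (Mod k).toSet, e.j = emb i k
  comm : ∀ i k l : ZFSet, i ∈ δ → k ∈ δ → l ∈ δ → i ∈ k → k ∈ l →
    ∀ x ∈ Mod i, emb k l (emb i k x) = emb i l x
  cp_emb : ∀ i : ZFSet, i ∈ δ → i ≠ ∅ → cp i = emb ∅ i κ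
  succ' : ∀ i : ZFSet, i ∈ δ → insert i i ∈ δ →
    IsUltrapowerMap (cp i) (Mod i) (Meas i) (Mod (insert i i)) (emb i (insert i i)) ∧
    (∀ Y : ZFSet, Y ∈ Meas (insert i i) ↔
      ∃ D : ZFSet, D ∈ Mod i ∧ Y ∈ emb i (insert i i) (Meas i ∩ D))
  limit' : ∀ l : ZFSet, l ∈ δ → l ≠ ∅ → (∀ i ∈ l, insert i i ∈ l) →
    (∀ y ∈ Mod l, ∃ i : ZFSet, i ∈ l ∧ ∃ x, x ∈ Mod i ∧ emb i l x = y) ∧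
    (∀ Y : ZFSet, Y ∈ Meas l ↔
      ∃ i : ZFSet, i ∈ l ∧ ∃ D, D ∈ Mod i ∧ Y ∈ emb i l (Meas i ∩ D))

/-- `⟨M, F⟩` is iterable: all its iterations (of any ordinal length) are wellfounded,
i.e. realized by transitive models. -/
def Iterable (κ M F : ZFSet.{u}) : Prop :=
  ∀ δ : ZFSet, δ.IsOrdinal → Nonempty (Iteration κ M F δ)

/-! ### Constructibility -/

/-- `X` is a subset of `M` definable over `⟨M, ∈⟩` with parameters. -/
def DefinableSubset (M X : ZFSet.{u}) : Prop :=
  X ⊆ M ∧ ∃ (n : ℕ) (φ : SetLang.Formula (Fin (n + 1))) (v : Fin n → ZFSet.{u})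
    (hv : ∀ i, v i ∈ M.toSet),
    ∀ a : ZFSet, a ∈ X ↔ ∃ ha : a ∈ M.toSet,
      φ.Realize (Fin.cons (⟨a, ha⟩ : M.toSet) (fun i => (⟨v i, hv i⟩ : M.toSet)))

/-- The set of all subsets of `M` definable over `⟨M, ∈⟩` with parameters. -/
noncomputable def DefSet (M : ZFSet.{u}) : ZFSet.{u} :=
  ZFSet.sep (fun X => DefinableSubset M X) (ZFSet.powerset M)

/-- `h` codes the constructible hierarchy up to `δ`: a function with domain `δ` such that
`h(β) = ⋃_{γ<β} Def(h(γ))` for every `β < δ`. -/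
def IsLHierarchy (δ h : ZFSet.{u}) : Prop :=
  δ.IsOrdinal ∧
  (∀ p ∈ h, ∃ β y : ZFSet, β ∈ δ ∧ p = ZFSet.pair β y) ∧
  (∀ β ∈ δ, ∃! y : ZFSet, ZFSet.pair β y ∈ h) ∧
  ∀ β y : ZFSet, ZFSet.pair β y ∈ h →
    ∀ z : ZFSet, z ∈ y ↔ ∃ γ x : ZFSet, γ ∈ β ∧ ZFSet.pair γ x ∈ h ∧ z ∈ DefSet x

/-- `x` is constructible: it appears at some level of some constructible hierarchy. -/
def Constructible (x : ZFSet.{u}) : Prop :=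
  ∃ δ h β y : ZFSet, IsLHierarchy δ h ∧ ZFSet.pair β y ∈ h ∧ x ∈ y

/-- The axiom of constructibility `V = L`. -/
def VeqL : Prop := ∀ x : ZFSet.{u}, Constructible x

/-! ### Normal measures -/

/-- `U` is a normal measure on `κ`: a `κ`-complete nonprincipal ultrafilter on `κ`
closed under diagonal intersections. -/
def IsNormalMeasure (κ U : ZFSet.{u}) : Prop :=
  (∀ X ∈ U, X ⊆ κ) ∧ κ ∈ U ∧ (∅ : ZFSet) ∉ U ∧
  (∀ X Y : ZFSet, X ∈ U → Y ∈ U → X ∩ Y ∈ U) ∧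
  (∀ X Y : ZFSet, X ∈ U → X ⊆ Y → Y ⊆ κ → Y ∈ U) ∧
  (∀ X : ZFSet, X ⊆ κ → (X ∈ U ∨ κ \ X ∈ U)) ∧
  (∀ ξ ∈ κ, ({ξ} : ZFSet) ∉ U) ∧
  (∀ γ f : ZFSet, γ ∈ κ → IsFuncInto γ U.toSet f →
    ZFSet.sep (fun ξ => ∀ a X : ZFSet, ZFSet.pair a X ∈ f → ξ ∈ X) κ ∈ U) ∧
  (∀ f : ZFSet, IsFuncInto κ U.toSet f →
    ZFSet.sep (fun ξ => ∀ a X : ZFSet, ZFSet.pair a X ∈ f → a ∈ ξ → ξ ∈ X) κ ∈ U)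

end LaverDiamond

open LaverDiamond

namespace LaverDiamond

section

open Filter Ordinal

/-- A nonprincipal, countably complete, normal ultrafilter concentrating on the ordinal `κ`. -/
structure NormalOn (κ : Ordinal.{u}) (U : Ultrafilter Ordinal.{u}) : Prop where
  lt : ∀ᶠ γ in (U : Filter Ordinal.{u}), γ < κ
  gt : ∀ ξ < κ, ∀ᶠ γ in (U : Filter Ordinal.{u}), ξ < γ
  press : ∀ f : Ordinal.{u} → Ordinal.{u}, (∀ᶠ γ in (U : Filter Ordinal.{u}), f γ < γ) →
    ∃ ξ, ∀ᶠ γ in (U : Filter Ordinal.{u}), f γ = ξ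
  omega_lt : ω < κ

namespace NormalOn

variable {κ : Ordinal.{u}} {U : Ultrafilter Ordinal.{u}}

theorem exists_eventually_eq_nat (hU : NormalOn κ U) (f : Ordinal.{u} → ℕ) :
    ∃ n, ∀ᶠ γ in (U : Filter Ordinal.{u}), f γ = n := by
  obtain ⟨ξ, hξ⟩ := hU.press (fun γ => (f γ : Ordinal.{u})) <| by
    filter_upwards [hU.gt _ hU.omega_lt] with γ hγ
    exact (natCast_lt_omega0 _).trans hγ
  obtain ⟨γ, hγ⟩ := hξ.exists
  refine ⟨f γ, ?_⟩
  filter_upwards [hξ] with δ hδ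
  exact_mod_cast hδ.trans hγ.symm

theorem exists_eventually_eq_countable (hU : NormalOn κ U) {ι : Type*} [Countable ι]
    (f : Ordinal.{u} → ι) : ∃ i, ∀ᶠ γ in (U : Filter Ordinal.{u}), f γ = i := by
  obtain ⟨g, hg⟩ := exists_injective_nat ι
  obtain ⟨n, hn⟩ := hU.exists_eventually_eq_nat (g ∘ f)
  obtain ⟨γ, hγ⟩ := hn.exists
  refine ⟨f γ, ?_⟩
  filter_upwards [hn] with δ hδ
  exact hg (hδ.trans hγ.symm)

theorem exists_bound (hU : NormalOn κ U) {γ : Ordinal.{u}} (hγ : γ < κ)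
    (g : Ordinal.{u} → Ordinal.{u}) (hg : ∀ η < γ, g η < κ) :
    ∃ δ < κ, ∀ η < γ, g η < δ := by
  by_contra! hcon
  choose! f hf using hcon
  obtain ⟨ξ, hξ⟩ := hU.press f <| by
    filter_upwards [hU.lt, hU.gt γ hγ] with δ h1 h2
    exact (hf δ h1).1.trans h2
  obtain ⟨δ₀, h0, h0'⟩ := (hξ.and hU.lt).exists
  have hlt : ξ < γ := h0 ▸ (hf δ₀ h0').1
  obtain ⟨δ, h1, h2, h3⟩ := (hξ.and (hU.lt.and (hU.gt _ (hg ξ hlt)))).exists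
  exact absurd h3 (not_lt.2 (h1 ▸ (hf δ h2).2))

theorem exists_bound_countable (hU : NormalOn κ U) {ι : Type*} [Countable ι]
    (g : ι → Ordinal.{u}) (hg : ∀ i, g i < κ) : ∃ δ < κ, ∀ i, g i < δ := by
  by_contra! hcon
  have : Nonempty ι := ⟨(hcon 0 (omega0_pos.trans hU.omega_lt)).choose⟩
  choose! f hf using hcon
  obtain ⟨i, hi⟩ := hU.exists_eventually_eq_countable f
  obtain ⟨δ, h1, h2, h3⟩ := (hi.and (hU.lt.and (hU.gt _ (hg i)))).exists
  exact absurd h3 (not_lt.2 (h1 ▸ hf δ h2))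

theorem exists_eventually_eq_list (hU : NormalOn κ U) (F : Ordinal.{u} → List Ordinal.{u})
    (hF : ∀ᶠ γ in (U : Filter Ordinal.{u}), ∀ x ∈ F γ, x < γ) :
    ∃ l, ∀ᶠ γ in (U : Filter Ordinal.{u}), F γ = l := by
  obtain ⟨n, hn⟩ := hU.exists_eventually_eq_nat (fun γ => (F γ).length)
  induction n generalizing F with
  | zero =>
    refine ⟨[], ?_⟩
    filter_upwards [hn] with γ hγ
    exact List.length_eq_zero_iff.1 hγ
  | succ n ih =>
    obtain ⟨ξ, hξ⟩ := hU.press (fun γ => (F γ).headD 0) <| by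
      filter_upwards [hn, hF] with γ h1 h2
      cases h : F γ with
      | nil => simp [h] at h1
      | cons a l => exact h2 _ (by simp [h])
    obtain ⟨l, hl⟩ := ih (fun γ => (F γ).tail)
      (by filter_upwards [hF] with γ h x hx using h x (List.mem_of_mem_tail hx))
      (by filter_upwards [hn] with γ h; simp [h])
    refine ⟨ξ :: l, ?_⟩
    filter_upwards [hn, hξ, hl] with γ h1 h2 h3
    cases h : F γ with
    | nil => simp [h] at h1
    | cons a m => simp_all

theorem diagonal (hU : NormalOn κ U) {ι : Type*} [Countable ι]
    (P : ι → List Ordinal.{u} → Ordinal.{u} → Prop)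
    (hP : ∀ i l, (∀ x ∈ l, x < κ) → ∀ᶠ γ in (U : Filter Ordinal.{u}), P i l γ) :
    ∀ᶠ γ in (U : Filter Ordinal.{u}), ∀ i l, (∀ x ∈ l, x < γ) → P i l γ := by
  by_contra hcon
  rw [← Ultrafilter.eventually_not] at hcon
  push Not at hcon
  obtain ⟨γ₀, i₀, -⟩ := hcon.exists
  have : Nonempty ι := ⟨i₀⟩
  choose! i l hl hil using fun γ (h : ∃ i l, (∀ x ∈ l, x < γ) ∧ ¬ P i l γ) => h
  obtain ⟨j, hj⟩ := hU.exists_eventually_eq_countable i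
  obtain ⟨m, hm⟩ := hU.exists_eventually_eq_list l (hcon.mono hl)
  obtain ⟨γ, h1, h2, h3⟩ := ((hcon.and hU.lt).and (hj.and hm)).exists
  obtain ⟨δ, h4, h5, h6, h7⟩ := (hcon.and (hj.and (hm.and
    (hP j m fun x hx => (hl γ h1.1 x (h3 ▸ hx)).trans h1.2)))).exists
  exact hil δ h4 (h5 ▸ h6 ▸ h7)

end NormalOn

/-- `H` is a set of diagonal indiscernibles for the relations `R i`. -/
def DiagIndisc (R : ℕ → List Ordinal.{u} → Prop) (H : Set Ordinal.{u}) : Prop :=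
  ∀ (i : ℕ) (l m m' : List Ordinal.{u}), m.length = m'.length →
    m.Pairwise (· < ·) → m'.Pairwise (· < ·) → (∀ x ∈ m, x ∈ H) → (∀ x ∈ m', x ∈ H) →
    (∀ x ∈ m, ∀ y ∈ l, y < x) → (∀ x ∈ m', ∀ y ∈ l, y < x) → (R i (l ++ m) ↔ R i (l ++ m'))

theorem DiagIndisc.mono {R : ℕ → List Ordinal.{u} → Prop} {H H' : Set Ordinal.{u}}
    (h : DiagIndisc R H) (hH : H' ⊆ H) : DiagIndisc R H' :=
  fun i l m m' h0 h1 h2 h3 h4 => h i l m m' h0 h1 h2 (fun x hx => hH (h3 x hx))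
    (fun x hx => hH (h4 x hx))

/-- The truth value of `R` at `l` extended by `n` generic points for the ultrafilter `U`. -/
def limRel (U : Ultrafilter Ordinal.{u}) (R : List Ordinal.{u} → Prop) :
    ℕ → List Ordinal.{u} → Prop
  | 0, l => R l
  | n + 1, l => ∀ᶠ γ in (U : Filter Ordinal.{u}), limRel U R n (l ++ [γ])

theorem NormalOn.exists_diagIndisc {κ : Ordinal.{u}} {U : Ultrafilter Ordinal.{u}}
    (hU : NormalOn κ U) (R : ℕ → List Ordinal.{u} → Prop) :
    ∃ H : Set Ordinal.{u}, (∀ᶠ γ in (U : Filter Ordinal.{u}), γ ∈ H) ∧ DiagIndisc R H := by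
  let H : Set Ordinal.{u} := {γ | ∀ (p : ℕ × ℕ) (l : List Ordinal.{u}), (∀ x ∈ l, x < γ) →
    (limRel U (R p.1) p.2 (l ++ [γ]) ↔ limRel U (R p.1) (p.2 + 1) l)}
  refine ⟨H, hU.diagonal _ ?_, ?_⟩
  · intro p l _
    by_cases h : limRel U (R p.1) (p.2 + 1) l
    · exact Filter.Eventually.mono h fun γ hγ => iff_of_true hγ h
    · exact (Ultrafilter.eventually_not.2 h).mono fun γ hγ => iff_of_false hγ h
  · have key : ∀ (i : ℕ) (m l : List Ordinal.{u}), m.Pairwise (· < ·) → (∀ x ∈ m, x ∈ H) →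
        (∀ x ∈ m, ∀ y ∈ l, y < x) → (R i (l ++ m) ↔ limRel U (R i) m.length l) := by
      intro i m
      induction m with
      | nil => intro l _ _ _; simp [limRel]
      | cons a m ih =>
        intro l h1 h2 h3
        rw [List.pairwise_cons] at h1
        have := ih (l ++ [a]) h1.2 (fun x hx => h2 x (by simp [hx])) (by
          intro x hx y hy
          rcases List.mem_append.1 hy with hy | hy
          · exact h3 x (by simp [hx]) y hy
          · rw [List.mem_singleton.1 hy]; exact h1.1 x hx)
        rw [List.append_assoc, List.singleton_append] at this
        rw [this]
        exact h2 a (by simp) (i, m.length) l (h3 a (by simp))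
    intro i l m m' h0 h1 h2 h3 h4 h5 h6
    rw [key i m l h1 h3 h5, key i m' l h2 h4 h6, h0]

/-- The binary relation coded by `R 0`, restricted to the ordinals below `h`. -/
def codedRel (R : ℕ → List Ordinal.{u} → Prop) (h : Ordinal.{u}) (ξ η : Ordinal.{u}) : Prop :=
  ξ < h ∧ η < h ∧ R 0 [ξ, η]

open Classical in
/-- The Mostowski collapse of a wellfounded relation on the ordinals below `h`. -/
noncomputable def collapse (h : Ordinal.{u}) (r : Ordinal.{u} → Ordinal.{u} → Prop)
    (ξ : Ordinal.{u}) : ZFSet.{u} :=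
  if wf : WellFounded r then
    wf.fix (C := fun _ => ZFSet.{u})
      (fun ξ ih => ZFSet.range (fun η : {η : Set.Iio h // r η ξ} => ih η.1 η.2)) ξ
  else ∅

theorem mem_collapse {h : Ordinal.{u}} {r : Ordinal.{u} → Ordinal.{u} → Prop}
    (wf : WellFounded r) {ξ : Ordinal.{u}} {z : ZFSet.{u}} :
    z ∈ collapse h r ξ ↔ ∃ η < h, r η ξ ∧ collapse h r η = z := by
  simp only [collapse, dif_pos wf]
  rw [wf.fix_eq, ZFSet.mem_range]
  constructor
  · rintro ⟨⟨⟨η, h1⟩, h2⟩, h3⟩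
    exact ⟨η, h1, h2, h3⟩
  · rintro ⟨η, h1, h2, h3⟩
    exact ⟨⟨⟨η, h1⟩, h2⟩, h3⟩

theorem rank_collapse_lt {κ : Ordinal.{u}} {U : Ultrafilter Ordinal.{u}} (hU : NormalOn κ U)
    {h : Ordinal.{u}} (hh : h < κ) {r : Ordinal.{u} → Ordinal.{u} → Prop}
    (wf : WellFounded r) (ξ : Ordinal.{u}) : (collapse h r ξ).rank < κ := by
  classical
  induction ξ using wf.induction with
  | _ ξ ih =>
    obtain ⟨δ, h1, h2⟩ := hU.exists_bound hh
      (fun η => if r η ξ then (collapse h r η).rank else 0) (by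
        intro η _
        split_ifs with hr
        · exact ih η hr
        · exact omega0_pos.trans hU.omega_lt)
    refine lt_of_le_of_lt (ZFSet.rank_le_iff.2 fun z hz => ?_) h1
    obtain ⟨η, h3, h4, rfl⟩ := (mem_collapse wf).1 hz
    simpa [h4] using h2 η h3

/-- The guess at `h` of the set coded by the relation `R 0` and the point `0`. -/
noncomputable def guess (R : ℕ → List Ordinal.{u} → Prop) (h : Ordinal.{u}) : ZFSet.{u} :=
  collapse h (codedRel R h) 0

/-- There is an unbounded set of diagonal indiscernibles below `γ` on which `l` guesses the set
coded by `R`. -/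
def Guesses (l : Ordinal.{u} → ZFSet.{u}) (γ : Ordinal.{u})
    (R : ℕ → List Ordinal.{u} → Prop) : Prop :=
  ∃ H : Set Ordinal.{u}, H ⊆ Set.Iio γ ∧ (∀ ξ < γ, ∃ η ∈ H, ξ < η) ∧ DiagIndisc R H ∧
    ∀ h ∈ H, l h = guess R h

/-- `R` is a wellfounded structure below `γ` not guessed by `l`. -/
def Missed (l : Ordinal.{u} → ZFSet.{u}) (γ : Ordinal.{u})
    (R : ℕ → List Ordinal.{u} → Prop) : Prop :=
  WellFounded (codedRel R γ) ∧ ¬ Guesses l γ R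

theorem Guesses.congr {l l' : Ordinal.{u} → ZFSet.{u}} {γ : Ordinal.{u}}
    {R : ℕ → List Ordinal.{u} → Prop} (h : Guesses l γ R) (hl : ∀ h < γ, l h = l' h) :
    Guesses l' γ R := by
  obtain ⟨H, h1, h2, h3, h4⟩ := h
  exact ⟨H, h1, h2, h3, fun x hx => (hl x (h1 hx)).symm.trans (h4 x hx)⟩

theorem Missed.congr {l l' : Ordinal.{u} → ZFSet.{u}} {γ : Ordinal.{u}}
    {R : ℕ → List Ordinal.{u} → Prop} (h : Missed l γ R) (hl : ∀ h < γ, l h = l' h) :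
    Missed l' γ R :=
  ⟨h.1, fun hg => h.2 (hg.congr fun x hx => (hl x hx).symm)⟩

open Classical in
/-- The Laver function: at `γ` it guesses the set coded by some structure missed so far. -/
noncomputable def laver : Ordinal.{u} → ZFSet.{u} :=
  (wellFounded_lt (α := Ordinal.{u})).fix fun γ ih =>
    if h : ∃ R, Missed (fun x => if hx : x < γ then ih x hx else ∅) γ R then guess h.choose γ else ∅

theorem laver_spec (γ : Ordinal.{u}) :
    (∃ R, Missed laver γ R ∧ laver γ = guess R γ) ∨
      ((¬ ∃ R, Missed laver γ R) ∧ laver γ = ∅) := by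
  classical
  have heq : laver γ = if h : ∃ R, Missed (fun x => if x < γ then laver x else ∅) γ R then
      guess h.choose γ else ∅ := by
    conv_lhs => rw [laver, WellFounded.fix_eq]
    rfl
  have hl : ∀ x < γ, (fun x => if x < γ then laver x else ∅) x = laver x := by
    intro x hx
    simp [hx]
  by_cases h : ∃ R, Missed (fun x => if x < γ then laver x else ∅) γ R
  · rw [dif_pos h] at heq
    exact Or.inl ⟨h.choose, h.choose_spec.congr hl, heq⟩
  · rw [dif_neg h] at heq
    exact Or.inr ⟨fun ⟨R, hR⟩ => h ⟨R, hR.congr fun x hx => (hl x hx).symm⟩, heq⟩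

theorem rank_laver_lt {κ : Ordinal.{u}} {U : Ultrafilter Ordinal.{u}} (hU : NormalOn κ U)
    {γ : Ordinal.{u}} (hγ : γ < κ) : (laver γ).rank < κ := by
  rcases laver_spec γ with ⟨R, h1, h2⟩ | ⟨-, h⟩
  · rw [h2]
    exact rank_collapse_lt hU hγ h1.1 _
  · rw [h, ZFSet.rank_empty]
    exact omega0_pos.trans hU.omega_lt

/-- A property of lists eventually agrees, below `γ`, with its limit along a normal ultrafilter. -/
theorem NormalOn.eventually_eq_lim {κ : Ordinal.{u}} {U : Ultrafilter Ordinal.{u}}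
    (hU : NormalOn κ U) (Q : Ordinal.{u} → ℕ → List Ordinal.{u} → Prop) :
    ∀ᶠ γ in (U : Filter Ordinal.{u}), ∀ (i : ℕ) (l : List Ordinal.{u}), (∀ x ∈ l, x < γ) →
      (Q γ i l ↔ ∀ᶠ δ in (U : Filter Ordinal.{u}), Q δ i l) := by
  refine hU.diagonal _ fun i l _ => ?_
  by_cases h : ∀ᶠ δ in (U : Filter Ordinal.{u}), Q δ i l
  · exact h.mono fun γ hγ => iff_of_true hγ h
  · exact (Ultrafilter.eventually_not.2 h).mono fun γ hγ => iff_of_false hγ h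

theorem codedRel_congr {R R' : ℕ → List Ordinal.{u} → Prop} {γ : Ordinal.{u}}
    (h : ∀ (i : ℕ) (l : List Ordinal.{u}), (∀ x ∈ l, x < γ) → (R i l ↔ R' i l))
    {δ : Ordinal.{u}} (hδ : δ ≤ γ) : codedRel R δ = codedRel R' δ := by
  funext ξ η
  simp only [codedRel, eq_iff_iff]
  refine and_congr_right fun h1 => and_congr_right fun h2 => h 0 _ ?_
  simp [h1.trans_le hδ, h2.trans_le hδ]

theorem guess_congr {R R' : ℕ → List Ordinal.{u} → Prop} {γ : Ordinal.{u}}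
    (h : ∀ (i : ℕ) (l : List Ordinal.{u}), (∀ x ∈ l, x < γ) → (R i l ↔ R' i l))
    {δ : Ordinal.{u}} (hδ : δ ≤ γ) : guess R δ = guess R' δ := by
  rw [guess, guess, codedRel_congr h hδ]

theorem DiagIndisc.congr {R R' : ℕ → List Ordinal.{u} → Prop} {γ : Ordinal.{u}}
    {H : Set Ordinal.{u}} (hd : DiagIndisc R H) (hH : H ⊆ Set.Iio γ)
    (h : ∀ (i : ℕ) (l : List Ordinal.{u}), (∀ x ∈ l, x < γ) → (R i l ↔ R' i l)) :
    DiagIndisc R' H := by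
  have key : ∀ (i : ℕ) (l m : List Ordinal.{u}), m ≠ [] → (∀ x ∈ m, x ∈ H) →
      (∀ x ∈ m, ∀ y ∈ l, y < x) → (R i (l ++ m) ↔ R' i (l ++ m)) := by
    intro i l m h0 h1 h2
    refine h i _ fun x hx => ?_
    obtain ⟨a, ha⟩ := List.exists_mem_of_ne_nil _ h0
    rcases List.mem_append.1 hx with hx | hx
    · exact (h2 a ha x hx).trans (hH (h1 a ha))
    · exact hH (h1 x hx)
  intro i l m m' h0 h1 h2 h3 h4 h5 h6
  by_cases hm : m = []
  · subst hm
    rw [List.eq_nil_of_length_eq_zero h0.symm]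
  · have hm' : m' ≠ [] := by
      rintro rfl
      exact hm (List.eq_nil_of_length_eq_zero h0)
    rw [← key i l m hm h3 h5, ← key i l m' hm' h4 h6]
    exact hd i l m m' h0 h1 h2 h3 h4 h5 h6

/-- If `R` is missed at `κ`, then it is missed at almost every `γ`. -/
theorem NormalOn.eventually_missed {κ : Ordinal.{u}} {U : Ultrafilter Ordinal.{u}}
    (hU : NormalOn κ U) {l : Ordinal.{u} → ZFSet.{u}} {R : ℕ → List Ordinal.{u} → Prop}
    (h : Missed l κ R) : ∀ᶠ γ in (U : Filter Ordinal.{u}), Missed l γ R := by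
  obtain ⟨hwf, hG⟩ := h
  have hwf' : ∀ γ < κ, WellFounded (codedRel R γ) := fun γ hγ =>
    Subrelation.wf (fun {a b} hab => ⟨hab.1.trans hγ, hab.2.1.trans hγ, hab.2.2⟩) hwf
  by_contra hcon
  have hgood : ∀ᶠ γ in (U : Filter Ordinal.{u}), Guesses l γ R := by
    filter_upwards [Ultrafilter.eventually_not.2 hcon, hU.lt] with γ h1 h2
    by_contra h3
    exact h1 ⟨hwf' γ h2, h3⟩
  choose! H hH using fun γ (h : Guesses l γ R) => h
  have hlim := hU.eventually_eq_lim (fun γ _ m => ∀ x ∈ m, x ∈ H γ)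
  set K : Set Ordinal.{u} := {ξ | ξ < κ ∧ ∀ᶠ δ in (U : Filter Ordinal.{u}), ξ ∈ H δ} with hK
  have hagree : ∀ᶠ γ in (U : Filter Ordinal.{u}), Guesses l γ R ∧ γ < κ ∧
      ∀ ξ < γ, (ξ ∈ H γ ↔ ξ ∈ K) := by
    filter_upwards [hlim, hgood, hU.lt] with γ h1 h2 h3
    refine ⟨h2, h3, fun ξ hξ => ?_⟩
    have := h1 0 [ξ] (by simpa using hξ)
    simpa [hK, hξ.trans h3] using this
  have hagree' : ∀ ξ < κ, ∃ γ, ξ < γ ∧ Guesses l γ R ∧ γ < κ ∧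
      ∀ ξ < γ, (ξ ∈ H γ ↔ ξ ∈ K) := fun ξ hξ => ((hU.gt ξ hξ).and hagree).exists
  refine hG ⟨K, fun ξ h => h.1, ?_, ?_, ?_⟩
  · intro ξ hξ
    obtain ⟨γ, h1, h2, h3, h4⟩ := hagree' ξ hξ
    obtain ⟨η, h5, h6⟩ := (hH γ h2).2.1 ξ h1
    exact ⟨η, (h4 η ((hH γ h2).1 h5)).1 h5, h6⟩
  · intro i p m m' h0 h1 h2 h3 h4 h5 h6
    obtain ⟨δ, h7, h8⟩ := hU.exists_bound_countable (ι := {x // x ∈ m ++ m'}) (fun x => x.1) (by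
      rintro ⟨x, hx⟩
      rcases List.mem_append.1 hx with hx | hx
      · exact (h3 x hx).1
      · exact (h4 x hx).1)
    obtain ⟨γ, h9, h10, h11, h12⟩ := hagree' δ h7
    refine (hH γ h10).2.2.1 i p m m' h0 h1 h2 (fun x hx => ?_) (fun x hx => ?_) h5 h6
    · exact (h12 x ((h8 ⟨x, by simp [hx]⟩).trans h9)).2 (h3 x hx)
    · exact (h12 x ((h8 ⟨x, by simp [hx]⟩).trans h9)).2 (h4 x hx)
  · intro h hh
    obtain ⟨γ, h1, h2, h3, h4⟩ := hagree' h hh.1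
    exact (hH γ h2).2.2.2 h ((h4 h h1).2 hh)

/-- The Laver function guesses, at a normal measure, every wellfounded structure. -/
theorem NormalOn.laver_guesses {κ : Ordinal.{u}} {U : Ultrafilter Ordinal.{u}}
    (hU : NormalOn κ U) (R : ℕ → List Ordinal.{u} → Prop) (hwf : WellFounded (codedRel R κ)) :
    Guesses laver κ R := by
  by_contra hcon
  have h1 : ∀ᶠ γ in (U : Filter Ordinal.{u}), ∃ S, Missed laver γ S ∧ laver γ = guess S γ := by
    filter_upwards [hU.eventually_missed ⟨hwf, hcon⟩] with γ hγ
    exact (laver_spec γ).resolve_right fun h => h.1 ⟨R, hγ⟩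
  choose! S hS hS' using fun γ (h : ∃ S, Missed laver γ S ∧ laver γ = guess S γ) => h
  set T : ℕ → List Ordinal.{u} → Prop := fun i l => ∀ᶠ δ in (U : Filter Ordinal.{u}), S δ i l
  have hT : ∀ᶠ γ in (U : Filter Ordinal.{u}), ∀ (i : ℕ) (l : List Ordinal.{u}),
      (∀ x ∈ l, x < γ) → (S γ i l ↔ T i l) := hU.eventually_eq_lim S
  have hguess : ∀ᶠ γ in (U : Filter Ordinal.{u}), laver γ = guess T γ := by
    filter_upwards [h1, hT] with γ h2 h3
    rw [hS' γ h2, guess_congr h3 le_rfl]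
  obtain ⟨H, hHU, hH⟩ := hU.exists_diagIndisc T
  set K : Set Ordinal.{u} := {γ | γ ∈ H ∧ γ < κ ∧ laver γ = guess T γ}
  have hKU : ∀ᶠ γ in (U : Filter Ordinal.{u}), γ ∈ K := hHU.and (hU.lt.and hguess)
  have hlimit : ∀ᶠ γ in (U : Filter Ordinal.{u}), ∀ ξ < γ, ∃ η ∈ K, η < γ ∧ ξ < η := by
    have := hU.diagonal (ι := Unit) (fun _ l γ => ∀ ξ ∈ l, ∃ η ∈ K, η < γ ∧ ξ < η) (by
      intro _ l hl
      obtain ⟨δ, h2, h3⟩ := hU.exists_bound_countable (ι := {x // x ∈ l}) (fun x => x.1)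
        (fun x => hl x.1 x.2)
      obtain ⟨η, h4, h5⟩ := (hKU.and (hU.gt δ h2)).exists
      filter_upwards [hU.gt η h4.2.1] with γ hγ ξ hξ
      exact ⟨η, h4, hγ, (h3 ⟨ξ, hξ⟩).trans h5⟩)
    filter_upwards [this] with γ hγ ξ hξ
    exact hγ () [ξ] (by simpa using hξ) ξ (by simp)
  obtain ⟨γ, h2, h3, h4⟩ := (h1.and (hT.and hlimit)).exists
  refine (hS γ h2).2 ⟨K ∩ Set.Iio γ, Set.inter_subset_right, fun ξ hξ => ?_, ?_, ?_⟩
  · obtain ⟨η, h5, h6, h7⟩ := h4 ξ hξ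
    exact ⟨η, ⟨h5, h6⟩, h7⟩
  · exact (hH.mono fun x hx => hx.1.1).congr Set.inter_subset_right
      fun i l hl => (h3 i l hl).symm
  · rintro h ⟨h5, h6⟩
    rw [h5.2.2, guess_congr h3 (le_of_lt h6)]

/-- The function symbols used to generate a hull: Skolem functions for the language of set theory,
together with a few functions specific to the construction. -/
inductive HullFunc : ℕ → Type
  | skolem (n m : ℕ) (φ : SetLang.BoundedFormula (Fin n) (m + 1)) : HullFunc (n + m)
  | ord : HullFunc 1
  | ordInv : HullFunc 1
  | graph : HullFunc 1
  | diff : HullFunc 2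
  | upair : HullFunc 2
  | proj : HullFunc 2
  | index : HullFunc 3

/-- The functional language of hulls. -/
def hullLang : FirstOrder.Language := ⟨HullFunc, fun _ => Empty⟩

instance : Countable SetLang.Symbols := by
  have h1 : Countable (Σ l, SetLang.Functions l) :=
    Function.Injective.countable (f := fun x => x.1) (fun x => (x.2 : Empty).elim)
  have h2 : Countable (Σ l, SetLang.Relations l) :=
    Function.Injective.countable (f := fun x => x.1) (by
      rintro ⟨_, ⟨⟩⟩ ⟨_, ⟨⟩⟩ _
      rfl)
  exact inferInstanceAs (Countable ((Σ l, SetLang.Functions l) ⊕ (Σ l, SetLang.Relations l)))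

instance : Countable (Σ k, hullLang.Functions k) := by
  have h (n m : ℕ) : Countable (SetLang.BoundedFormula (Fin n) (m + 1)) :=
    Function.Injective.countable
      (f := fun φ => (⟨m + 1, φ⟩ : Σ k, SetLang.BoundedFormula (Fin n) k)) (by
        intro φ ψ h
        simpa using h)
  let f : (Σ n m : ℕ, SetLang.BoundedFormula (Fin n) (m + 1)) ⊕ ℕ → Σ k, HullFunc k
    | .inl ⟨n, m, φ⟩ => ⟨_, .skolem n m φ⟩
    | .inr 0 => ⟨_, .ord⟩
    | .inr 1 => ⟨_, .ordInv⟩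
    | .inr 2 => ⟨_, .graph⟩
    | .inr 3 => ⟨_, .diff⟩
    | .inr 4 => ⟨_, .upair⟩
    | .inr 5 => ⟨_, .proj⟩
    | .inr _ => ⟨_, .index⟩
  refine Function.Surjective.countable (f := f) ?_
  rintro ⟨_, φ⟩
  cases φ with
  | skolem n m φ => exact ⟨.inl ⟨n, m, φ⟩, rfl⟩
  | ord => exact ⟨.inr 0, rfl⟩
  | ordInv => exact ⟨.inr 1, rfl⟩
  | graph => exact ⟨.inr 2, rfl⟩
  | diff => exact ⟨.inr 3, rfl⟩
  | upair => exact ⟨.inr 4, rfl⟩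
  | proj => exact ⟨.inr 5, rfl⟩
  | index => exact ⟨.inr 6, rfl⟩

theorem realize_term_congr {L : FirstOrder.Language} {X : Type*} [L.Structure X] {α : Type*}
    [DecidableEq α] (t : L.Term α) {v w : α → X} (h : ∀ x ∈ t.varFinset, v x = w x) :
    t.realize v = t.realize w := by
  induction t with
  | var x => exact h x (by simp [Language.Term.varFinset])
  | func f ts ih =>
    simp only [Language.Term.realize]
    congr 1
    funext i
    refine ih i fun x hx => h x ?_
    simp only [Language.Term.varFinset, Finset.mem_biUnion]
    exact ⟨i, Finset.mem_univ _, hx⟩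

/-- An atomic formula in natural number variables, about the relation `E` (for `true`) or about
equality (for `false`). -/
abbrev Atom := Bool × hullLang.Term ℕ × hullLang.Term ℕ

section

variable {κ θ : Ordinal.{u}}

/-- Terms with parameters below `κ`, in indiscernibles indexed by the ordinals below `θ`. -/
abbrev HullTerm (κ θ : Ordinal.{u}) := hullLang.Term (Set.Iio κ ⊕ Set.Iio θ)

instance : Small.{u} (HullTerm κ θ) :=
  ⟨⟨hullLang.Term (Shrink.{u} (Set.Iio κ ⊕ Set.Iio θ)),
    ⟨Language.Term.relabelEquiv (equivShrink _)⟩⟩⟩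

/-- The set of variables of a term. -/
def HullTerm.vars (t : HullTerm κ θ) : Set (Set.Iio κ ⊕ Set.Iio θ) := by
  classical exact ↑t.varFinset

theorem HullTerm.finite_vars (t : HullTerm κ θ) : t.vars.Finite := by
  classical exact t.varFinset.finite_toSet

/-- The assignment `π` maps the indices in `F` increasingly into `H`, above the parameters in
`F`. -/
def Suitable (H : Set Ordinal.{u}) (F : Set (Set.Iio κ ⊕ Set.Iio θ))
    (π : Set.Iio θ → Set.Iio κ) : Prop :=
  (∀ α β, .inr α ∈ F → .inr β ∈ F → α < β → π α < π β) ∧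
  (∀ α, .inr α ∈ F → (π α).1 ∈ H) ∧ ∀ ξ α, .inl ξ ∈ F → .inr α ∈ F → ξ < π α

theorem Suitable.mono {H : Set Ordinal.{u}} {F G : Set (Set.Iio κ ⊕ Set.Iio θ)}
    {π : Set.Iio θ → Set.Iio κ} (h : Suitable H F π) (hG : G ⊆ F) : Suitable H G π :=
  ⟨fun α β h1 h2 => h.1 α β (hG h1) (hG h2), fun α h1 => h.2.1 α (hG h1),
    fun ξ α h1 h2 => h.2.2 ξ α (hG h1) (hG h2)⟩

/-- `H` has elements above any countable set of ordinals below `κ`. -/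
def CountablyUnbounded (κ : Ordinal.{u}) (H : Set Ordinal.{u}) : Prop :=
  ∀ S : Set (Set.Iio κ), S.Countable → ∃ η : Set.Iio κ, η.1 ∈ H ∧ ∀ x ∈ S, x < η

theorem CountablyUnbounded.exists_suitable [Nonempty (Set.Iio κ)] {H : Set Ordinal.{u}}
    (hH : CountablyUnbounded κ H)
    (F : Set (Set.Iio κ ⊕ Set.Iio θ)) (hF : F.Countable) :
    ∃ π : Set.Iio θ → Set.Iio κ, Suitable H F π := by
  classical
  choose! f hf using hH
  let S (α : Set.Iio θ) (ih : ∀ β, β < α → Set.Iio κ) : Set (Set.Iio κ) :=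
    {x | .inl x ∈ F ∨ ∃ β, ∃ h : β < α, .inr β ∈ F ∧ ih β h = x}
  have hS (α) (ih) : (S α ih).Countable := by
    have h1 : (Sum.inl ⁻¹' F : Set (Set.Iio κ)).Countable := hF.preimage Sum.inl_injective
    have h2 : (Sum.inr ⁻¹' F : Set (Set.Iio θ)).Countable := hF.preimage Sum.inr_injective
    refine (h1.union (h2.image fun β => if h : β < α then ih β h else f ∅)).mono ?_
    rintro x (h | ⟨β, h, hβ, rfl⟩)
    · exact Or.inl h
    · exact Or.inr ⟨β, hβ, by simp [h]⟩
  let π : Set.Iio θ → Set.Iio κ :=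
    (wellFounded_lt (α := Set.Iio θ)).fix (C := fun _ => Set.Iio κ) fun α ih => f (S α ih)
  have hπ (α) : π α = f (S α fun β _ => π β) := WellFounded.fix_eq _ _ _
  have h1 (α) : (π α).1 ∈ H := by
    rw [hπ]
    exact (hf _ (hS _ _)).1
  have h2 (α) : ∀ x ∈ S α (fun β _ => π β), x < π α := by
    intro x hx
    rw [hπ]
    exact (hf _ (hS _ _)).2 x hx
  exact ⟨π, fun α β hα _ h => h2 β _ (Or.inr ⟨α, h, hα, rfl⟩), fun α _ => h1 α,
    fun ξ α hξ _ => h2 α _ (Or.inl hξ)⟩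

/-- There is an ultrafilter on assignments concentrating on the suitable ones. -/
theorem CountablyUnbounded.exists_ultrafilter [Nonempty (Set.Iio κ)] {H : Set Ordinal.{u}}
    (hH : CountablyUnbounded κ H) (θ : Ordinal.{u}) :
    ∃ W : Ultrafilter (Set.Iio θ → Set.Iio κ), ∀ F : Set (Set.Iio κ ⊕ Set.Iio θ), F.Finite →
      ∀ᶠ π in (W : Filter (Set.Iio θ → Set.Iio κ)), Suitable H F π := by
  classical
  let f (F : Finset (Set.Iio κ ⊕ Set.Iio θ)) : Filter (Set.Iio θ → Set.Iio κ) :=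
    𝓟 {π | Suitable H F π}
  have hne : (⨅ F, f F).NeBot := by
    refine iInf_neBot_of_directed (fun F G => ⟨F ∪ G, ?_, ?_⟩) fun F => ?_
    · exact principal_mono.2 fun π hπ => Suitable.mono hπ (by simp)
    · exact principal_mono.2 fun π hπ => Suitable.mono hπ (by simp)
    · exact principal_neBot_iff.2 (hH.exists_suitable _ F.countable_toSet)
  refine ⟨Ultrafilter.of (⨅ F, f F), fun F hF => ?_⟩
  refine (Ultrafilter.of_le (⨅ F, f F)).trans (iInf_le f hF.toFinset) ?_
  simp [f]

end

section

variable {κ θ : Ordinal.{u}} [Nonempty (Set.Iio κ)] [hullLang.Structure (Set.Iio κ)]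
  (E : Set.Iio κ → Set.Iio κ → Prop)

/-- The relation `E`, or equality. -/
def atomHolds (b : Bool) (x y : Set.Iio κ) : Prop := if b then E x y else x = y

open Classical in
/-- Read the `i`-th entry of a list of ordinals below `κ`. -/
noncomputable def listVal (κ : Ordinal.{u}) [Nonempty (Set.Iio κ)] (l : List Ordinal.{u})
    (i : ℕ) : Set.Iio κ :=
  if h : l.getD i 0 < κ then ⟨l.getD i 0, h⟩ else Classical.arbitrary _

/-- The relation on lists of ordinals defined by an atomic formula. -/
def atomRel (a : Atom) (l : List Ordinal.{u}) : Prop :=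
  atomHolds E a.1 (a.2.1.realize (listVal κ l)) (a.2.2.realize (listVal κ l))

/-- The value of a term at an assignment of the indiscernibles. -/
noncomputable def HullTerm.val (t : HullTerm κ θ) (π : Set.Iio θ → Set.Iio κ) : Set.Iio κ :=
  t.realize (Sum.elim id π)

variable {E}

theorem atomHolds_congr {H : Set Ordinal.{u}}
    (hH : ∀ a : Atom, DiagIndisc (fun _ => atomRel (κ := κ) E a) H) (b : Bool)
    (t t' : HullTerm κ θ) {π π' : Set.Iio θ → Set.Iio κ}
    (hπ : Suitable H (t.vars ∪ t'.vars) π) (hπ' : Suitable H (t.vars ∪ t'.vars) π') :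
    atomHolds E b (t.val π) (t'.val π) ↔ atomHolds E b (t.val π') (t'.val π') := by
  classical
  let F := t.varFinset ∪ t'.varFinset
  have hF : (F : Set (Set.Iio κ ⊕ Set.Iio θ)) = t.vars ∪ t'.vars := by
    simp only [F, Finset.coe_union, HullTerm.vars]
  rw [← hF] at hπ hπ'
  let l : List (Set.Iio κ) := (F.preimage Sum.inl Sum.inl_injective.injOn).toList
  let c : List (Set.Iio θ) := (F.preimage Sum.inr Sum.inr_injective.injOn).sort (· ≤ ·)
  have hl (ξ) : ξ ∈ l ↔ Sum.inl ξ ∈ F := by simp [l]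
  have hc (α) : α ∈ c ↔ Sum.inr α ∈ F := by simp [c]
  have hcs : c.Pairwise (· < ·) := (Finset.sortedLT_sort _).pairwise
  let L : List (Set.Iio κ ⊕ Set.Iio θ) := l.map Sum.inl ++ c.map Sum.inr
  have hL : ∀ x ∈ F, x ∈ L := by
    rintro (ξ | α) h
    · simpa [L] using (hl ξ).2 h
    · simpa [L] using (hc α).2 h
  choose! g hg using fun (x) (hx : x ∈ F) => List.mem_iff_getElem?.1 (hL x hx)
  have hval (ρ : Set.Iio θ → Set.Iio κ) (x) (hx : x ∈ F) :
      listVal κ (l.map Subtype.val ++ c.map (fun α => (ρ α).1)) (g x) =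
        Sum.elim id ρ x := by
    have h1 : l.map Subtype.val ++ c.map (fun α => (ρ α).1) =
        L.map (fun x => (Sum.elim id ρ x).1) := by
      simp [L]
    have h2 : (l.map Subtype.val ++ c.map (fun α => (ρ α).1)).getD (g x) 0 =
        (Sum.elim id ρ x).1 := by
      rw [h1, List.getD_eq_getElem?_getD, List.getElem?_map, hg x hx]
      rfl
    have h4 : (Sum.elim id ρ x).1 < κ := (Sum.elim id ρ x).2
    simp only [listVal, h2]
    simp [h4]
  have hreal (ρ : Set.Iio θ → Set.Iio κ) (r : HullTerm κ θ) (hr : r.varFinset ⊆ F) :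
      (r.relabel g).realize
        (listVal κ (l.map Subtype.val ++ c.map (fun α => (ρ α).1))) = r.val ρ := by
    rw [Language.Term.realize_relabel]
    exact realize_term_congr r fun x hx => hval ρ x (hr hx)
  have key := hH (b, t.relabel g, t'.relabel g) 0
    (l.map Subtype.val) (c.map (fun α => (π α).1)) (c.map (fun α => (π' α).1)) (by simp) ?_ ?_
    ?_ ?_ ?_ ?_
  · simp only [atomRel] at key
    rwa [hreal π t Finset.subset_union_left, hreal π t' Finset.subset_union_right,
      hreal π' t Finset.subset_union_left, hreal π' t' Finset.subset_union_right] at key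
  · rw [List.pairwise_map]
    exact hcs.imp_of_mem fun h1 h2 h3 => hπ.1 _ _ ((hc _).1 h1) ((hc _).1 h2) h3
  · rw [List.pairwise_map]
    exact hcs.imp_of_mem fun h1 h2 h3 => hπ'.1 _ _ ((hc _).1 h1) ((hc _).1 h2) h3
  · simp only [List.mem_map]
    rintro _ ⟨α, hα, rfl⟩
    exact hπ.2.1 α ((hc _).1 hα)
  · simp only [List.mem_map]
    rintro _ ⟨α, hα, rfl⟩
    exact hπ'.2.1 α ((hc _).1 hα)
  · simp only [List.mem_map]
    rintro _ ⟨α, hα, rfl⟩ _ ⟨ξ, hξ, rfl⟩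
    exact hπ.2.2 ξ α ((hl _).1 hξ) ((hc _).1 hα)
  · simp only [List.mem_map]
    rintro _ ⟨α, hα, rfl⟩ _ ⟨ξ, hξ, rfl⟩
    exact hπ'.2.2 ξ α ((hl _).1 hξ) ((hc _).1 hα)

end

/-- The Mostowski collapse of a wellfounded relation on a small type. -/
noncomputable def mostowski {X : Type*} [Small.{u} X] {r : X → X → Prop} (wf : WellFounded r) :
    X → ZFSet.{u} :=
  wf.fix fun x ih => ZFSet.range (fun y : {y // r y x} => ih y.1 y.2)

theorem mem_mostowski {X : Type*} [Small.{u} X] {r : X → X → Prop} (wf : WellFounded r) {x : X}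
    {z : ZFSet.{u}} : z ∈ mostowski wf x ↔ ∃ y, r y x ∧ mostowski wf y = z := by
  rw [mostowski, wf.fix_eq, ZFSet.mem_range]
  constructor
  · rintro ⟨⟨y, hy⟩, h⟩
    exact ⟨y, hy, h⟩
  · rintro ⟨y, hy, h⟩
    exact ⟨⟨y, hy⟩, h⟩

/-- The ultrafilter `W` concentrates on assignments into `H` that are suitable for any finite
set of variables. -/
def Concentrates {κ θ : Ordinal.{u}} (W : Ultrafilter (Set.Iio θ → Set.Iio κ))
    (H : Set Ordinal.{u}) : Prop :=
  ∀ F : Set (Set.Iio κ ⊕ Set.Iio θ), F.Finite →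
    ∀ᶠ π in (W : Filter (Set.Iio θ → Set.Iio κ)), Suitable H F π

theorem Concentrates.eventually_lt {κ θ : Ordinal.{u}} {W : Ultrafilter (Set.Iio θ → Set.Iio κ)}
    {H : Set Ordinal.{u}} (hW : Concentrates W H) (ξ : Set.Iio κ) (α : Set.Iio θ) :
    ∀ᶠ π in (W : Filter (Set.Iio θ → Set.Iio κ)), ξ < π α :=
  (hW {.inl ξ, .inr α} (by simp)).mono fun π hπ => hπ.2.2 ξ α (by simp) (by simp)

section

variable {κ θ : Ordinal.{u}} [hullLang.Structure (Set.Iio κ)]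

/-- The membership relation between terms. -/
def termRel (E : Set.Iio κ → Set.Iio κ → Prop) (W : Ultrafilter (Set.Iio θ → Set.Iio κ))
    (t t' : HullTerm κ θ) : Prop :=
  ∀ᶠ π in (W : Filter (Set.Iio θ → Set.Iio κ)), E (t.val π) (t'.val π)

variable [Nonempty (Set.Iio κ)] {E : Set.Iio κ → Set.Iio κ → Prop}
  {W : Ultrafilter (Set.Iio θ → Set.Iio κ)} {H : Set Ordinal.{u}}

theorem eventually_atomHolds_iff
    (hH : ∀ a : Atom, DiagIndisc (fun _ => atomRel (κ := κ) E a) H) (hW : Concentrates W H)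
    (b : Bool) (t t' : HullTerm κ θ) {π : Set.Iio θ → Set.Iio κ}
    (hπ : Suitable H (t.vars ∪ t'.vars) π) :
    (∀ᶠ ρ in (W : Filter (Set.Iio θ → Set.Iio κ)), atomHolds E b (t.val ρ) (t'.val ρ)) ↔
      atomHolds E b (t.val π) (t'.val π) := by
  have h := hW _ (t.finite_vars.union t'.finite_vars)
  constructor
  · intro h1
    obtain ⟨ρ, h2, h3⟩ := (h.and h1).exists
    exact (atomHolds_congr hH b t t' h2 hπ).1 h3
  · intro h1
    exact h.mono fun ρ hρ => (atomHolds_congr hH b t t' hρ hπ).2 h1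

theorem wellFounded_termRel (hE : WellFounded E) (hcu : CountablyUnbounded κ H)
    (hH : ∀ a : Atom, DiagIndisc (fun _ => atomRel (κ := κ) E a) H) (hW : Concentrates W H) :
    WellFounded (termRel E W) := by
  rw [wellFounded_iff_isEmpty_descending_chain]
  refine ⟨fun ⟨f, hf⟩ => ?_⟩
  obtain ⟨π, hπ⟩ := hcu.exists_suitable (⋃ n, (f n).vars)
    (Set.countable_iUnion fun n => (f n).finite_vars.countable)
  refine (wellFounded_iff_isEmpty_descending_chain.1 hE).false ⟨fun n => (f n).val π, fun n => ?_⟩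
  have := (eventually_atomHolds_iff hH hW true (f (n + 1)) (f n) (π := π)
    (hπ.mono (Set.union_subset (Set.subset_iUnion (fun n => (f n).vars) _)
      (Set.subset_iUnion (fun n => (f n).vars) _)))).1
  simpa [atomHolds] using this (by simpa [atomHolds, termRel] using hf n)

/-- A term whose values are almost everywhere below the first indiscernible is almost everywhere
constant. -/
theorem eventually_val_eq_of_lt
    (hH : ∀ a : Atom, DiagIndisc (fun _ => atomRel (κ := κ) E a) H) (hW : Concentrates W H)
    (t : HullTerm κ θ) {i : Set.Iio θ} (hi : ∀ α, i ≤ α)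
    (h : ∀ᶠ π in (W : Filter (Set.Iio θ → Set.Iio κ)), t.val π < π i) :
    ∃ δ, ∀ᶠ π in (W : Filter (Set.Iio θ → Set.Iio κ)), t.val π = δ := by
  obtain ⟨π, h1, h2⟩ := (h.and (hW _ (t.finite_vars.union (Set.finite_singleton (.inr i))))).exists
  refine ⟨t.val π, ?_⟩
  have h3 : Suitable H (t.vars ∪ HullTerm.vars (.var (.inl (t.val π)))) π := by
    have hv : HullTerm.vars (.var (.inl (t.val π)) : HullTerm κ θ) = {.inl (t.val π)} := by
      simp [HullTerm.vars, Language.Term.varFinset]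
    rw [hv]
    refine ⟨fun α β hα hβ => h2.1 α β ?_ ?_, fun α hα => h2.2.1 α ?_, fun ξ α hξ hα => ?_⟩
    · simpa using Or.inr (by simpa using hα)
    · simpa using Or.inr (by simpa using hβ)
    · simpa using Or.inr (by simpa using hα)
    · have hα' : Sum.inr α ∈ t.vars := by simpa using hα
      rcases hξ with hξ | hξ
      · exact h2.2.2 ξ α (Or.inl hξ) (Or.inl hα')
      · obtain rfl : ξ = t.val π := by simpa using hξ
        rcases (hi α).eq_or_lt with rfl | h4
        · exact h1
        · exact h1.trans (h2.1 _ _ (Or.inr rfl) (Or.inl hα') h4)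
  have := (eventually_atomHolds_iff hH hW false t (.var (.inl (t.val π))) h3).2
  simpa [atomHolds, HullTerm.val] using this

end

/-- The functions of the hull language are interpreted on the codes `Iio κ` of the elements of `M`
as intended.  Here `P` is a family of sets indexed by pairs of codes. -/
structure HullSpec {κ : Ordinal.{u}} [hullLang.Structure (Set.Iio κ)] {M : ZFSet.{u}}
    (s : Set.Iio κ ≃ M.toSet) (P : Set.Iio κ → Set.Iio κ → ZFSet.{u})
    (l : Ordinal.{u} → ZFSet.{u}) : Prop where
  skolem : ∀ (n m : ℕ) (φ : SetLang.BoundedFormula (Fin n) (m + 1)) (w : Fin (n + m) → Set.Iio κ),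
    φ.Realize (fun i => s (w (Fin.castAdd m i))) (Fin.snoc (α := fun _ => M.toSet)
      (fun i => s (w (Fin.natAdd n i)))
      (s (Language.Structure.funMap (L := hullLang) (HullFunc.skolem n m φ) w))) →
    ∀ a, φ.Realize (fun i => s (w (Fin.castAdd m i))) (Fin.snoc (α := fun _ => M.toSet)
      (fun i => s (w (Fin.natAdd n i))) a)
  ord : ∀ w : Fin 1 → Set.Iio κ,
    (s (Language.Structure.funMap (L := hullLang) HullFunc.ord w) : ZFSet.{u}) = (w 0).1.toZFSet
  ordInv : ∀ (w : Fin 1 → Set.Iio κ) (ξ : Set.Iio κ), (s (w 0) : ZFSet.{u}) = ξ.1.toZFSet →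
    Language.Structure.funMap (L := hullLang) HullFunc.ordInv w = ξ
  graph : ∀ w : Fin 1 → Set.Iio κ,
    (s (Language.Structure.funMap (L := hullLang) HullFunc.graph w) : ZFSet.{u}) =
      ZFSet.pair (w 0).1.toZFSet (l (w 0).1)
  diff : ∀ w : Fin 2 → Set.Iio κ, w 0 ≠ w 1 →
    ¬ ((s (Language.Structure.funMap (L := hullLang) HullFunc.diff w) : ZFSet.{u}) ∈
        (s (w 0) : ZFSet.{u}) ↔
      (s (Language.Structure.funMap (L := hullLang) HullFunc.diff w) : ZFSet.{u}) ∈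
        (s (w 1) : ZFSet.{u}))
  upair : ∀ w : Fin 2 → Set.Iio κ,
    ({(s (w 0) : ZFSet.{u}), (s (w 1) : ZFSet.{u})} : ZFSet.{u}) ∈ M →
    (s (Language.Structure.funMap (L := hullLang) HullFunc.upair w) : ZFSet.{u}) =
      {(s (w 0) : ZFSet.{u}), (s (w 1) : ZFSet.{u})}
  proj : ∀ w : Fin 2 → Set.Iio κ, P (w 0) (w 1) ∈ M →
    (s (Language.Structure.funMap (L := hullLang) HullFunc.proj w) : ZFSet.{u}) = P (w 0) (w 1)
  index : ∀ w : Fin 3 → Set.Iio κ,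
    (∃ η < w 0, (s η : ZFSet.{u}) ∈ (s (w 1) : ZFSet.{u}) ∧ P (w 0) η = s (w 2)) →
    Language.Structure.funMap (L := hullLang) HullFunc.index w < w 0 ∧
    (s (Language.Structure.funMap (L := hullLang) HullFunc.index w) : ZFSet.{u}) ∈
      (s (w 1) : ZFSet.{u}) ∧
    P (w 0) (Language.Structure.funMap (L := hullLang) HullFunc.index w) = s (w 2)

theorem exists_hullSpec {κ : Ordinal.{u}} [hne : Nonempty (Set.Iio κ)] {M : ZFSet.{u}}
    (hM : M.IsTransitive) (s : Set.Iio κ ≃ M.toSet) (P : Set.Iio κ → Set.Iio κ → ZFSet.{u})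
    (l : Ordinal.{u} → ZFSet.{u}) (hord : ∀ ξ : Set.Iio κ, ξ.1.toZFSet ∈ M)
    (hl : ∀ ξ : Set.Iio κ, ZFSet.pair ξ.1.toZFSet (l ξ.1) ∈ M) :
    ∃ _ : hullLang.Structure (Set.Iio κ), HullSpec s P l := by
  classical
  have total {n : ℕ} (Q : (Fin n → Set.Iio κ) → Set.Iio κ → Prop) :
      ∃ f : (Fin n → Set.Iio κ) → Set.Iio κ, ∀ w, (∃ x, Q w x) → Q w (f w) :=
    ⟨fun w => Classical.epsilon (Q w), fun w h => Classical.epsilon_spec h⟩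
  have hcode (z : ZFSet.{u}) (hz : z ∈ M) : ∃ x, (s x : ZFSet.{u}) = z :=
    ⟨s.symm ⟨z, hz⟩, by simp⟩
  choose sk hsk using fun (n m : ℕ) (φ : SetLang.BoundedFormula (Fin n) (m + 1)) =>
    total (n := n + m) fun w x =>
      φ.Realize (fun i => s (w (Fin.castAdd m i))) (Fin.snoc (α := fun _ => M.toSet)
        (fun i => s (w (Fin.natAdd n i))) (s x)) →
      ∀ a, φ.Realize (fun i => s (w (Fin.castAdd m i))) (Fin.snoc (α := fun _ => M.toSet)
        (fun i => s (w (Fin.natAdd n i))) a)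
  obtain ⟨fo, hfo⟩ := total (n := 1) fun w x => (s x : ZFSet.{u}) = (w 0).1.toZFSet
  obtain ⟨fi, hfi⟩ := total (n := 1) fun w x => (s (w 0) : ZFSet.{u}) = x.1.toZFSet
  obtain ⟨fg, hfg⟩ := total (n := 1) fun w x =>
    (s x : ZFSet.{u}) = ZFSet.pair (w 0).1.toZFSet (l (w 0).1)
  obtain ⟨fd, hfd⟩ := total (n := 2) fun w x =>
    ¬ ((s x : ZFSet.{u}) ∈ (s (w 0) : ZFSet.{u}) ↔ (s x : ZFSet.{u}) ∈ (s (w 1) : ZFSet.{u}))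
  obtain ⟨fu, hfu⟩ := total (n := 2) fun w x =>
    (s x : ZFSet.{u}) = {(s (w 0) : ZFSet.{u}), (s (w 1) : ZFSet.{u})}
  obtain ⟨fp, hfp⟩ := total (n := 2) fun w x => (s x : ZFSet.{u}) = P (w 0) (w 1)
  obtain ⟨fx, hfx⟩ := total (n := 3) fun w η =>
    η < w 0 ∧ (s η : ZFSet.{u}) ∈ (s (w 1) : ZFSet.{u}) ∧ P (w 0) η = s (w 2)
  refine ⟨⟨fun {n} f => match n, f with
    | _, .skolem n m φ => sk n m φ
    | _, .ord => fo
    | _, .ordInv => fi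
    | _, .graph => fg
    | _, .diff => fd
    | _, .upair => fu
    | _, .proj => fp
    | _, .index => fx, fun {_} r => r.elim⟩, ?_⟩
  refine @HullSpec.mk _ (_) _ _ _ _ ?_ ?_ ?_ ?_ ?_ ?_ ?_ ?_
  · intro n m φ w h
    refine hsk n m φ w ?_ h
    by_contra! hcon
    obtain ⟨h1, a, h2⟩ := hcon (s.symm ⟨(s (Classical.arbitrary _) : ZFSet), (s _).2⟩)
    obtain ⟨h3, -⟩ := hcon (s.symm a)
    exact h2 (by simpa using h3)
  · exact fun w => hfo w (hcode _ (hord _))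
  · intro w ξ h
    have := hfi w ⟨ξ, h⟩
    exact Subtype.ext (Ordinal.toZFSet_injective (this.symm.trans h))
  · exact fun w => hfg w (hcode _ (hl _))
  · intro w h
    refine hfd w ?_
    by_contra! hcon
    refine h (s.injective (Subtype.ext (ZFSet.ext fun z => ⟨fun hz => ?_, fun hz => ?_⟩)))
    · obtain ⟨x, rfl⟩ := hcode z (hM _ (s _).2 hz)
      exact (hcon x).1 hz
    · obtain ⟨x, rfl⟩ := hcode z (hM _ (s _).2 hz)
      exact (hcon x).2 hz
  · exact fun w h => hfu w (hcode _ h)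
  · exact fun w h => hfp w (hcode _ h)
  · rintro w ⟨η, h⟩
    exact hfx w ⟨η, h⟩

/-- The membership relation on codes of elements of `M`. -/
def memCode {κ : Ordinal.{u}} {M : ZFSet.{u}} (s : Set.Iio κ ≃ M.toSet) (ξ η : Set.Iio κ) : Prop :=
  (s ξ : ZFSet.{u}) ∈ (s η : ZFSet.{u})

theorem wellFounded_memCode {κ : Ordinal.{u}} {M : ZFSet.{u}} (s : Set.Iio κ ≃ M.toSet) :
    WellFounded (memCode s) :=
  InvImage.wf (fun ξ => (s ξ : ZFSet.{u})) ZFSet.mem_wf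

section

variable {κ θ : Ordinal.{u}} [hullLang.Structure (Set.Iio κ)] {M : ZFSet.{u}}
  {s : Set.Iio κ ≃ M.toSet} {P : Set.Iio κ → Set.Iio κ → ZFSet.{u}} {l : Ordinal.{u} → ZFSet.{u}}
  {W : Ultrafilter (Set.Iio θ → Set.Iio κ)}

@[simp]
theorem HullTerm.val_param (ξ : Set.Iio κ) (π : Set.Iio θ → Set.Iio κ) :
    HullTerm.val (.var (.inl ξ)) π = ξ := rfl

@[simp]
theorem HullTerm.val_index (α : Set.Iio θ) (π : Set.Iio θ → Set.Iio κ) :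
    HullTerm.val (.var (.inr α)) π = π α := rfl

variable (wf : WellFounded (termRel (memCode s) W))

theorem mostowski_mem_of_termRel {t t' : HullTerm κ θ} (h : termRel (memCode s) W t t') :
    mostowski wf t ∈ mostowski wf t' :=
  (mem_mostowski wf).2 ⟨t, h, rfl⟩

theorem mostowski_congr {t t' : HullTerm κ θ}
    (h : ∀ᶠ π in (W : Filter (Set.Iio θ → Set.Iio κ)), t.val π = t'.val π) :
    mostowski wf t = mostowski wf t' := by
  ext z
  simp only [mem_mostowski]
  refine exists_congr fun y => and_congr_left fun _ => eventually_congr ?_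
  filter_upwards [h] with π hπ
  rw [hπ]

/-- The transitive set of the collapses of all terms. -/
noncomputable def termModel : ZFSet.{u} := ZFSet.range (mostowski wf)

theorem mostowski_mem_termModel (t : HullTerm κ θ) : mostowski wf t ∈ termModel wf :=
  ZFSet.mem_range.2 ⟨t, rfl⟩

theorem isTransitive_termModel : (termModel wf).IsTransitive := by
  intro x hx z hz
  obtain ⟨t, rfl⟩ := ZFSet.mem_range.1 hx
  obtain ⟨y, -, rfl⟩ := (mem_mostowski wf).1 hz
  exact mostowski_mem_termModel wf y

/-- The collapse of a term, as an element of the model. -/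
noncomputable def toModel (t : HullTerm κ θ) : (termModel wf).toSet :=
  ⟨mostowski wf t, mostowski_mem_termModel wf t⟩

theorem toModel_surjective : Function.Surjective (toModel wf) := by
  rintro ⟨x, hx⟩
  obtain ⟨t, rfl⟩ := ZFSet.mem_range.1 hx
  exact ⟨t, rfl⟩

theorem eventually_eq_of_mostowski_eq (hs : HullSpec s P l) {t t' : HullTerm κ θ}
    (h : mostowski wf t = mostowski wf t') :
    ∀ᶠ π in (W : Filter (Set.Iio θ → Set.Iio κ)), t.val π = t'.val π := by
  induction t using wf.induction generalizing t' with
  | _ t ih =>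
    by_contra hcon
    let d : HullTerm κ θ := .func HullFunc.diff ![t, t']
    have h1 : ∀ᶠ π in (W : Filter (Set.Iio θ → Set.Iio κ)),
        ¬ (memCode s (d.val π) (t.val π) ↔ memCode s (d.val π) (t'.val π)) := by
      filter_upwards [Ultrafilter.eventually_not.2 hcon] with π hπ
      exact hs.diff (fun i => HullTerm.val (![t, t'] i) π) hπ
    have h2 : (∀ᶠ π in (W : Filter (Set.Iio θ → Set.Iio κ)), memCode s (d.val π) (t.val π)) ∨
        (∀ᶠ π in (W : Filter (Set.Iio θ → Set.Iio κ)), memCode s (d.val π) (t'.val π)) := by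
      rw [← Ultrafilter.eventually_or]
      filter_upwards [h1] with π hπ
      tauto
    rcases h2 with h2 | h2
    · have h3 := mostowski_mem_of_termRel wf h2
      rw [h] at h3
      obtain ⟨y, h4, h5⟩ := (mem_mostowski wf).1 h3
      have h6 := ih d h2 h5.symm
      obtain ⟨π, h7, h8, h9, h10⟩ := (h1.and (h2.and (h4.and h6))).exists
      rw [h10] at h7 h8
      exact h7 (iff_of_true h8 h9)
    · have h3 := mostowski_mem_of_termRel wf h2
      rw [← h] at h3
      obtain ⟨y, h4, h5⟩ := (mem_mostowski wf).1 h3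
      have h6 := ih y h4 h5
      obtain ⟨π, h7, h8, h9, h10⟩ := (h1.and (h2.and (h4.and h6))).exists
      rw [h10] at h9
      exact h7 (iff_of_true h9 h8)

theorem mostowski_eq_iff (hs : HullSpec s P l) {t t' : HullTerm κ θ} :
    mostowski wf t = mostowski wf t' ↔
    ∀ᶠ π in (W : Filter (Set.Iio θ → Set.Iio κ)), t.val π = t'.val π :=
  ⟨eventually_eq_of_mostowski_eq wf hs, mostowski_congr wf⟩

theorem mostowski_mem_iff (hs : HullSpec s P l) {t t' : HullTerm κ θ} :
    mostowski wf t ∈ mostowski wf t' ↔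
    ∀ᶠ π in (W : Filter (Set.Iio θ → Set.Iio κ)), memCode s (t.val π) (t'.val π) := by
  refine ⟨fun h => ?_, mostowski_mem_of_termRel wf⟩
  obtain ⟨y, h1, h2⟩ := (mem_mostowski wf).1 h
  filter_upwards [h1, eventually_eq_of_mostowski_eq wf hs h2] with π h3 h4
  rwa [← h4]

theorem realize_toModel (hs : HullSpec s P l) {n m : ℕ} (φ : SetLang.BoundedFormula (Fin n) m)
    (v : Fin n → HullTerm κ θ) (xs : Fin m → HullTerm κ θ) :
    φ.Realize (fun i => toModel wf (v i)) (fun i => toModel wf (xs i)) ↔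
      ∀ᶠ π in (W : Filter (Set.Iio θ → Set.Iio κ)),
        φ.Realize (fun i => s ((v i).val π)) (fun i => s ((xs i).val π)) := by
  have hterm {m : ℕ} (t : SetLang.Term (Fin n ⊕ Fin m)) (xs : Fin m → HullTerm κ θ) :
      ∃ r : HullTerm κ θ, t.realize (Sum.elim (fun i => toModel wf (v i))
        (fun i => toModel wf (xs i))) = toModel wf r ∧ ∀ π : Set.Iio θ → Set.Iio κ,
        t.realize (Sum.elim (fun i => s ((v i).val π)) (fun i => s ((xs i).val π))) =
          s (r.val π) := by
    rcases t with (i | i) | ⟨f, _⟩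
    · exact ⟨v i, rfl, fun _ => rfl⟩
    · exact ⟨xs i, rfl, fun _ => rfl⟩
    · exact f.elim
  induction φ with
  | falsum => simp [Language.BoundedFormula.Realize, W.neBot.ne]
  | equal t₁ t₂ =>
    obtain ⟨r₁, h1, h2⟩ := hterm t₁ xs
    obtain ⟨r₂, h3, h4⟩ := hterm t₂ xs
    simp only [Language.BoundedFormula.Realize, h1, h2, h3, h4, EmbeddingLike.apply_eq_iff_eq]
    rw [← mostowski_eq_iff wf hs]
    exact Subtype.ext_iff
  | rel R ts =>
    cases R
    obtain ⟨r₁, h1, h2⟩ := hterm (ts 0) xs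
    obtain ⟨r₂, h3, h4⟩ := hterm (ts 1) xs
    have key (X : Set ZFSet.{u}) (w : Fin 2 → X) : Language.Structure.RelMap (L := SetLang)
        memRel.mem w ↔ (w 0 : ZFSet.{u}) ∈ (w 1 : ZFSet.{u}) := Iff.rfl
    simp only [Language.BoundedFormula.Realize, key, h1, h2, h3, h4]
    exact mostowski_mem_iff wf hs
  | imp φ ψ ih1 ih2 =>
    simp only [Language.BoundedFormula.realize_imp, ih1, ih2, Ultrafilter.eventually_imp]
  | @all m φ ih =>
    have hsnoc {X : Type (u + 1)} (f : HullTerm κ θ → X) (t : HullTerm κ θ) :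
        Fin.snoc (α := fun _ => X) (fun i => f (xs i)) (f t) =
          fun i => f (Fin.snoc (α := fun _ => HullTerm κ θ) xs t i) := by
      funext i
      refine Fin.lastCases ?_ (fun i => ?_) i <;> simp
    simp only [Language.BoundedFormula.realize_all, (toModel_surjective wf).forall]
    simp only [hsnoc (toModel wf), ih]
    constructor
    · intro h
      let t : HullTerm κ θ := .func (HullFunc.skolem n m φ) (Fin.append v xs)
      filter_upwards [h t] with π hπ a
      have := hs.skolem n m φ (fun i => HullTerm.val (Fin.append v xs i) π)
      simp only [Fin.append_left, Fin.append_right] at this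
      refine this ?_ a
      rw [← hsnoc (fun t : HullTerm κ θ => s (t.val π))] at hπ
      exact hπ
    · intro h t
      filter_upwards [h] with π hπ
      rw [← hsnoc (fun t : HullTerm κ θ => s (t.val π))]
      exact hπ _

open Classical in
/-- The elementary embedding of `M` into the term model. -/
noncomputable def modelEmb (hs : HullSpec s P l) : ClassEmb M.toSet (termModel wf).toSet where
  j x := if h : x ∈ M.toSet then mostowski wf (.var (.inl (s.symm ⟨x, h⟩))) else ∅
  maps x hx := by
    rw [dif_pos hx]
    exact mostowski_mem_termModel wf _
  elem {n} φ v hv := by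
    have h := realize_toModel wf hs φ (fun i => .var (.inl (s.symm ⟨v i, hv i⟩))) Fin.elim0
    have h0 (π : Set.Iio θ → Set.Iio κ) :
        (fun i : Fin 0 => s (HullTerm.val (Fin.elim0 i) π)) = default := Subsingleton.elim _ _
    have h1 : (fun i : Fin 0 => toModel wf (Fin.elim0 i)) = default := Subsingleton.elim _ _
    simp only [HullTerm.val_param, Equiv.apply_symm_apply, h0, h1, eventually_const] at h
    simp only [dif_pos (hv _)]
    exact h.symm

theorem modelEmb_apply (hs : HullSpec s P l) (ξ : Set.Iio κ) :
    (modelEmb wf hs).j (s ξ) = mostowski wf (.var (.inl ξ)) := by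
  simp [modelEmb]

end

section

variable {κ θ : Ordinal.{u}} [hullLang.Structure (Set.Iio κ)] {M : ZFSet.{u}}
  {s : Set.Iio κ ≃ M.toSet} {P : Set.Iio κ → Set.Iio κ → ZFSet.{u}} {l : Ordinal.{u} → ZFSet.{u}}
  {W : Ultrafilter (Set.Iio θ → Set.Iio κ)}

/-- The term for the von Neumann ordinal of the value of a term. -/
def HullTerm.ord (t : HullTerm κ θ) : HullTerm κ θ := .func HullFunc.ord ![t]

/-- The term for the unordered pair of the values of two terms. -/
def HullTerm.upair (t t' : HullTerm κ θ) : HullTerm κ θ := .func HullFunc.upair ![t, t']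

/-- The term for `P` at the values of two terms. -/
def HullTerm.proj (t t' : HullTerm κ θ) : HullTerm κ θ := .func HullFunc.proj ![t, t']

variable (wf : WellFounded (termRel (memCode s) W))

theorem exists_mostowski_eq_of_mem {t : HullTerm κ θ} {z : ZFSet.{u}} (h : z ∈ mostowski wf t) :
    ∃ y : HullTerm κ θ, mostowski wf y = z ∧
      ∀ᶠ π in (W : Filter (Set.Iio θ → Set.Iio κ)),
        (s (y.val π) : ZFSet.{u}) ∈ (s (t.val π) : ZFSet.{u}) := by
  obtain ⟨y, h1, h2⟩ := (mem_mostowski wf).1 h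
  exact ⟨y, h2, h1⟩

theorem HullSpec.coe_ord (hs : HullSpec s P l) (t : HullTerm κ θ) (π : Set.Iio θ → Set.Iio κ) :
    (s (t.ord.val π) : ZFSet.{u}) = (t.val π).1.toZFSet :=
  hs.ord fun i => HullTerm.val (![t] i) π

theorem HullSpec.coe_upair (hs : HullSpec s P l) (t t' : HullTerm κ θ) (π : Set.Iio θ → Set.Iio κ)
    (h : ({(s (t.val π) : ZFSet.{u}), (s (t'.val π) : ZFSet.{u})} : ZFSet.{u}) ∈ M) :
    (s ((t.upair t').val π) : ZFSet.{u}) =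
      {(s (t.val π) : ZFSet.{u}), (s (t'.val π) : ZFSet.{u})} :=
  hs.upair (fun i => HullTerm.val (![t, t'] i) π) h

theorem HullSpec.coe_proj (hs : HullSpec s P l) (t t' : HullTerm κ θ) (π : Set.Iio θ → Set.Iio κ)
    (h : P (t.val π) (t'.val π) ∈ M) :
    (s ((t.proj t').val π) : ZFSet.{u}) = P (t.val π) (t'.val π) :=
  hs.proj (fun i => HullTerm.val (![t, t'] i) π) h

theorem mostowski_mem_iff_coe (hs : HullSpec s P l) {t t' : HullTerm κ θ} :
    mostowski wf t ∈ mostowski wf t' ↔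
    ∀ᶠ π in (W : Filter (Set.Iio θ → Set.Iio κ)),
      (s (t.val π) : ZFSet.{u}) ∈ (s (t'.val π) : ZFSet.{u}) :=
  mostowski_mem_iff wf hs

theorem mostowski_eq_iff_coe (hs : HullSpec s P l) {t t' : HullTerm κ θ} :
    mostowski wf t = mostowski wf t' ↔
    ∀ᶠ π in (W : Filter (Set.Iio θ → Set.Iio κ)),
      (s (t.val π) : ZFSet.{u}) = (s (t'.val π) : ZFSet.{u}) := by
  rw [mostowski_eq_iff wf hs]
  refine eventually_congr (.of_forall fun π => ?_)
  rw [← Subtype.ext_iff, s.apply_eq_iff_eq]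

theorem isTransitive_mostowski (hs : HullSpec s P l) {t : HullTerm κ θ}
    (h : ∀ᶠ π in (W : Filter (Set.Iio θ → Set.Iio κ)), (s (t.val π) : ZFSet.{u}).IsTransitive) :
    (mostowski wf t).IsTransitive := by
  intro z hz w hw
  obtain ⟨y, rfl, h1⟩ := exists_mostowski_eq_of_mem wf hz
  obtain ⟨x, rfl, h2⟩ := exists_mostowski_eq_of_mem wf hw
  rw [mostowski_mem_iff_coe wf hs]
  filter_upwards [h, h1, h2] with π h3 h4 h5
  exact h3 _ h4 h5

theorem isOrdinal_mostowski (hs : HullSpec s P l) {t : HullTerm κ θ}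
    (h : ∀ᶠ π in (W : Filter (Set.Iio θ → Set.Iio κ)), (s (t.val π) : ZFSet.{u}).IsOrdinal) :
    (mostowski wf t).IsOrdinal := by
  rw [ZFSet.isOrdinal_iff_forall_mem_isTransitive]
  refine ⟨isTransitive_mostowski wf hs (h.mono fun π hπ => hπ.isTransitive), fun z hz => ?_⟩
  obtain ⟨y, rfl, h1⟩ := exists_mostowski_eq_of_mem wf hz
  refine isTransitive_mostowski wf hs ?_
  filter_upwards [h, h1] with π h2 h3
  exact (h2.mem h3).isTransitive

theorem mostowski_upair (hs : HullSpec s P l) {t x y : HullTerm κ θ}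
    (h : ∀ᶠ π in (W : Filter (Set.Iio θ → Set.Iio κ)),
      (s (t.val π) : ZFSet.{u}) = {(s (x.val π) : ZFSet.{u}), (s (y.val π) : ZFSet.{u})}) :
    mostowski wf t = {mostowski wf x, mostowski wf y} := by
  ext z
  rw [ZFSet.mem_pair]
  constructor
  · intro hz
    obtain ⟨w, rfl, h1⟩ := exists_mostowski_eq_of_mem wf hz
    rw [mostowski_eq_iff_coe wf hs, mostowski_eq_iff_coe wf hs, ← Ultrafilter.eventually_or]
    filter_upwards [h, h1] with π h2 h3
    rwa [h2, ZFSet.mem_pair] at h3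
  · rintro (rfl | rfl)
    · rw [mostowski_mem_iff_coe wf hs]
      filter_upwards [h] with π h2
      simp [h2]
    · rw [mostowski_mem_iff_coe wf hs]
      filter_upwards [h] with π h2
      simp [h2]

theorem mostowski_pair (hs : HullSpec s P l) (hM : M.IsTransitive) {t x y : HullTerm κ θ}
    (h : ∀ᶠ π in (W : Filter (Set.Iio θ → Set.Iio κ)),
      (s (t.val π) : ZFSet.{u}) = ZFSet.pair (s (x.val π)) (s (y.val π))) :
    mostowski wf t = ZFSet.pair (mostowski wf x) (mostowski wf y) := by
  have h1 (a b : ZFSet.{u}) : ZFSet.pair a b = {{a, a}, {a, b}} := by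
    rw [ZFSet.pair, ZFSet.pair_eq_singleton]
  have h2 : ∀ᶠ π in (W : Filter (Set.Iio θ → Set.Iio κ)),
      (s ((x.upair x).val π) : ZFSet.{u}) = {(s (x.val π) : ZFSet.{u}), (s (x.val π) : ZFSet.{u})} ∧
      (s ((x.upair y).val π) : ZFSet.{u}) =
        {(s (x.val π) : ZFSet.{u}), (s (y.val π) : ZFSet.{u})} := by
    filter_upwards [h] with π h3
    have h4 : (s (t.val π) : ZFSet.{u}) ∈ M := (s (t.val π)).2
    rw [h3, h1] at h4
    exact ⟨hs.coe_upair _ _ _ (hM _ h4 (by simp)), hs.coe_upair _ _ _ (hM _ h4 (by simp))⟩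
  rw [h1, ← mostowski_upair wf hs (h2.mono fun _ h => h.1),
    ← mostowski_upair wf hs (h2.mono fun _ h => h.2)]
  refine mostowski_upair wf hs ?_
  filter_upwards [h, h2] with π h3 h4
  rw [h3, h4.1, h4.2, h1]

theorem le_rank_mostowski_ord_index (hs : HullSpec s P l)
    {H : Set Ordinal.{u}} (hW : Concentrates W H)
    (α : Set.Iio θ) :
    α.1 ≤ (mostowski wf (HullTerm.ord (.var (.inr α)))).rank := by
  induction α using (wellFounded_lt (α := Set.Iio θ)).induction with
  | _ α ih =>
    refine le_of_forall_lt fun β hβ => ?_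
    refine (ih ⟨β, hβ.trans α.2⟩ hβ).trans_lt (ZFSet.rank_lt_of_mem ?_)
    rw [mostowski_mem_iff_coe wf hs]
    filter_upwards [hW {.inr ⟨β, hβ.trans α.2⟩, .inr α} (by simp)] with π hπ
    rw [hs.coe_ord, hs.coe_ord, HullTerm.val_index, HullTerm.val_index,
      Ordinal.toZFSet_mem_toZFSet_iff]
    exact hπ.1 _ _ (by simp) (by simp) hβ

variable [Nonempty (Set.Iio κ)] {H : Set Ordinal.{u}}

theorem exists_toZFSet_of_eventually_mem (hs : HullSpec s P l)
    (hH : ∀ a : Atom, DiagIndisc (fun _ => atomRel (κ := κ) (memCode s) a) H)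
    (hW : Concentrates W H) {i : Set.Iio θ} (hi : ∀ α, i ≤ α) {y : HullTerm κ θ}
    (h : ∀ᶠ π in (W : Filter (Set.Iio θ → Set.Iio κ)),
      (s (y.val π) : ZFSet.{u}) ∈ (π i).1.toZFSet) :
    ∃ γ : Set.Iio κ, (∀ᶠ π in (W : Filter (Set.Iio θ → Set.Iio κ)),
      (s (y.val π) : ZFSet.{u}) = γ.1.toZFSet) := by
  let x : HullTerm κ θ := .func HullFunc.ordInv ![y]
  have h1 : ∀ᶠ π in (W : Filter (Set.Iio θ → Set.Iio κ)),
      x.val π < π i ∧ (s (y.val π) : ZFSet.{u}) = (x.val π).1.toZFSet := by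
    filter_upwards [h] with π hπ
    obtain ⟨γ, h2, h3⟩ := Ordinal.mem_toZFSet_iff.1 hπ
    have h4 : x.val π = ⟨γ, h2.trans (π i).2⟩ :=
      hs.ordInv (fun i => HullTerm.val (![y] i) π) _ h3.symm
    rw [h4]
    exact ⟨h2, h3.symm⟩
  obtain ⟨δ, hδ⟩ := eventually_val_eq_of_lt hH hW x hi (h1.mono fun _ h => h.1)
  refine ⟨δ, ?_⟩
  filter_upwards [h1, hδ] with π h2 h3
  rw [h2.2, h3]

theorem mostowski_ord_param (hs : HullSpec s P l)
    (hH : ∀ a : Atom, DiagIndisc (fun _ => atomRel (κ := κ) (memCode s) a) H)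
    (hW : Concentrates W H) {i : Set.Iio θ} (hi : ∀ α, i ≤ α) (δ : Set.Iio κ) :
    mostowski wf (HullTerm.ord (.var (.inl δ))) = δ.1.toZFSet := by
  induction δ using (wellFounded_lt (α := Set.Iio κ)).induction with
  | _ δ ih =>
    ext z
    constructor
    · intro hz
      obtain ⟨y, rfl, h1⟩ := exists_mostowski_eq_of_mem wf hz
      simp only [hs.coe_ord, HullTerm.val_param] at h1
      obtain ⟨γ, h2⟩ := exists_toZFSet_of_eventually_mem hs hH hW hi (y := y) (by
        filter_upwards [h1, hW.eventually_lt δ i] with π h2 h3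
        exact (ZFSet.isOrdinal_toZFSet _).isTransitive _ (Ordinal.toZFSet_mem_toZFSet_iff.2 h3) h2)
      obtain ⟨π, h3, h4⟩ := (h1.and h2).exists
      rw [h4, Ordinal.toZFSet_mem_toZFSet_iff] at h3
      have h5 : mostowski wf y = mostowski wf (HullTerm.ord (.var (.inl γ))) := by
        rw [mostowski_eq_iff_coe wf hs]
        filter_upwards [h2] with π h6
        rw [h6, hs.coe_ord, HullTerm.val_param]
      rw [h5, ih γ h3, Ordinal.toZFSet_mem_toZFSet_iff]
      exact h3
    · intro hz
      obtain ⟨γ, h1, rfl⟩ := Ordinal.mem_toZFSet_iff.1 hz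
      have h2 := ih ⟨γ, h1.trans δ.2⟩ h1
      rw [← h2, mostowski_mem_iff_coe wf hs]
      refine .of_forall fun π => ?_
      rw [hs.coe_ord, hs.coe_ord, HullTerm.val_param, HullTerm.val_param,
        Ordinal.toZFSet_mem_toZFSet_iff]
      exact h1

theorem mostowski_ord_index (hs : HullSpec s P l)
    (hH : ∀ a : Atom, DiagIndisc (fun _ => atomRel (κ := κ) (memCode s) a) H)
    (hW : Concentrates W H) {i : Set.Iio θ} (hi : ∀ α, i ≤ α) :
    mostowski wf (HullTerm.ord (.var (.inr i))) = κ.toZFSet := by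
  ext z
  constructor
  · intro hz
    obtain ⟨y, rfl, h1⟩ := exists_mostowski_eq_of_mem wf hz
    simp only [hs.coe_ord, HullTerm.val_index] at h1
    obtain ⟨γ, h2⟩ := exists_toZFSet_of_eventually_mem hs hH hW hi h1
    have h5 : mostowski wf y = mostowski wf (HullTerm.ord (.var (.inl γ))) := by
      rw [mostowski_eq_iff_coe wf hs]
      filter_upwards [h2] with π h6
      rw [h6, hs.coe_ord, HullTerm.val_param]
    rw [h5, mostowski_ord_param wf hs hH hW hi, Ordinal.toZFSet_mem_toZFSet_iff]
    exact γ.2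
  · intro hz
    obtain ⟨γ, h1, rfl⟩ := Ordinal.mem_toZFSet_iff.1 hz
    rw [← mostowski_ord_param wf hs hH hW hi ⟨γ, h1⟩, mostowski_mem_iff_coe wf hs]
    filter_upwards [hW.eventually_lt ⟨γ, h1⟩ i] with π hπ
    rw [hs.coe_ord, hs.coe_ord, HullTerm.val_param, HullTerm.val_index,
      Ordinal.toZFSet_mem_toZFSet_iff]
    exact hπ

theorem mostowski_proj (hs : HullSpec s P l)
    (hH : ∀ a : Atom, DiagIndisc (fun _ => atomRel (κ := κ) (memCode s) a) H)
    (hW : Concentrates W H) {i : Set.Iio θ} (hi : ∀ α, i ≤ α) (hM : M.IsTransitive)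
    (hP : ∀ h ξ z, ξ < h → (z ∈ P h ξ ↔ ∃ η < h, memCode s η ξ ∧ P h η = z)) (ξ : Set.Iio κ)
    (h : ∀ᶠ π in (W : Filter (Set.Iio θ → Set.Iio κ)), P (π i) ξ ∈ M) :
    mostowski wf (HullTerm.proj (.var (.inr i)) (.var (.inl ξ))) = s ξ := by
  induction ξ using (wellFounded_memCode s).induction with
  | _ ξ ih =>
    have hproj (ξ : Set.Iio κ) (h : ∀ᶠ π in (W : Filter (Set.Iio θ → Set.Iio κ)), P (π i) ξ ∈ M) :
        ∀ᶠ π in (W : Filter (Set.Iio θ → Set.Iio κ)), (s (HullTerm.val (HullTerm.proj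
          (.var (.inr i)) (.var (.inl ξ))) π) : ZFSet.{u}) = P (π i) ξ := by
      filter_upwards [h] with π hπ
      exact hs.coe_proj _ _ π hπ
    have hlow (η : Set.Iio κ) (hη : memCode s η ξ) :
        ∀ᶠ π in (W : Filter (Set.Iio θ → Set.Iio κ)), P (π i) η ∈ P (π i) ξ := by
      filter_upwards [hW.eventually_lt η i, hW.eventually_lt ξ i] with π hπ hξ
      exact (hP _ _ _ hξ).2 ⟨η, hπ, hη, rfl⟩
    have hlow' (η : Set.Iio κ) (hη : memCode s η ξ) :
        ∀ᶠ π in (W : Filter (Set.Iio θ → Set.Iio κ)), P (π i) η ∈ M := by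
      filter_upwards [hlow η hη, h] with π h1 h2
      exact hM _ h2 h1
    ext z
    constructor
    · intro hz
      obtain ⟨y, rfl, h1⟩ := exists_mostowski_eq_of_mem wf hz
      let x : HullTerm κ θ := .func HullFunc.index ![.var (.inr i), .var (.inl ξ), y]
      have h2 : ∀ᶠ π in (W : Filter (Set.Iio θ → Set.Iio κ)), x.val π < π i ∧
          memCode s (x.val π) ξ ∧ P (π i) (x.val π) = s (y.val π) := by
        filter_upwards [h1, hproj ξ h, hW.eventually_lt ξ i] with π h3 h4 h5
        rw [h4, hP _ _ _ h5] at h3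
        exact hs.index (fun j => HullTerm.val
          ((![.var (.inr i), .var (.inl ξ), y] : Fin 3 → HullTerm κ θ) j) π) h3
      obtain ⟨η, hη⟩ := eventually_val_eq_of_lt hH hW x hi (h2.mono fun _ h => h.1)
      have h3 : ∀ᶠ π in (W : Filter (Set.Iio θ → Set.Iio κ)),
          memCode s η ξ ∧ P (π i) η = s (y.val π) := by
        filter_upwards [h2, hη] with π h3 h4
        rw [h4] at h3
        exact h3.2
      have h4 : memCode s η ξ := h3.exists.choose_spec.1
      have h5 : mostowski wf y =
          mostowski wf (HullTerm.proj (.var (.inr i)) (.var (.inl η))) := by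
        rw [mostowski_eq_iff_coe wf hs]
        filter_upwards [h3, hproj η (hlow' η h4)] with π h6 h7
        rw [h7, h6.2]
      rw [h5, ih η h4 (hlow' η h4)]
      exact h4
    · intro hz
      obtain ⟨η, hη⟩ : ∃ η, s η = ⟨z, hM _ (s ξ).2 hz⟩ := s.surjective _
      have h1 : memCode s η ξ := by
        simpa [memCode, hη] using hz
      have h2 := ih η h1 (hlow' η h1)
      rw [hη] at h2
      change _ = z at h2
      rw [← h2, mostowski_mem_iff_coe wf hs]
      filter_upwards [hproj η (hlow' η h1), hproj ξ h, hlow η h1] with π h3 h4 h5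
      rwa [h3, h4]

end

theorem HullSpec.exists_unfolding {κ : Ordinal.{u}} (θ : Ordinal.{u})
    [hullLang.Structure (Set.Iio κ)] [Nonempty (Set.Iio κ)] {M : ZFSet.{u}}
    {s : Set.Iio κ ≃ M.toSet} {P : Set.Iio κ → Set.Iio κ → ZFSet.{u}}
    {l : Ordinal.{u} → ZFSet.{u}} (hs : HullSpec s P l) (hM : M.IsTransitive)
    {H : Set Ordinal.{u}} (hcu : CountablyUnbounded κ H)
    (hH : ∀ a : Atom, DiagIndisc (fun _ => atomRel (κ := κ) (memCode s) a) H)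
    (hP : ∀ h ξ z, ξ < h → (z ∈ P h ξ ↔ ∃ η < h, memCode s η ξ ∧ P h η = z))
    (hκ : κ.toZFSet ∈ M) {L : ZFSet.{u}} (hLM : L ∈ M)
    (hL : ∀ γ < κ, ZFSet.pair γ.toZFSet (l γ) ∈ L) (a : Set.Iio κ)
    (hguess : ∀ h : Set.Iio κ, h.1 ∈ H → l h = P h a) :
    ∃ N : ZFSet.{u}, N.IsTransitive ∧ ∃ e : ClassEmb M.toSet N.toSet, CritPt e.j κ.toZFSet ∧
      θ.toZFSet ∈ e.j κ.toZFSet ∧ ZFSet.pair κ.toZFSet (s a) ∈ e.j L := by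
  obtain ⟨W, hW⟩ := hcu.exists_ultrafilter (θ + 1)
  replace hW : Concentrates W H := hW
  have wf := wellFounded_termRel (wellFounded_memCode s) hcu hH hW
  let i : Set.Iio (θ + 1) := ⟨0, by simp⟩
  have hi (α) : i ≤ α := Subtype.mk_le_mk.2 zero_le
  obtain ⟨k, hk⟩ : ∃ k, s k = ⟨κ.toZFSet, hκ⟩ := s.surjective _
  obtain ⟨f, hf⟩ : ∃ f, s f = ⟨L, hLM⟩ := s.surjective _
  have hjκ : (modelEmb wf hs).j κ.toZFSet = mostowski wf (.var (.inl k)) := by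
    rw [← modelEmb_apply wf hs k, hk]
  have hjL : (modelEmb wf hs).j L = mostowski wf (.var (.inl f)) := by
    rw [← modelEmb_apply wf hs f, hf]
  have hmem (α) : mostowski wf (HullTerm.ord (.var (.inr α))) ∈ mostowski wf (.var (.inl k)) := by
    rw [mostowski_mem_iff_coe wf hs]
    refine .of_forall fun π => ?_
    rw [hs.coe_ord, HullTerm.val_param, hk, Ordinal.toZFSet_mem_toZFSet_iff]
    exact (π α).2
  have hord : (mostowski wf (.var (.inl k))).IsOrdinal := by
    refine isOrdinal_mostowski wf hs (.of_forall fun π => ?_)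
    rw [HullTerm.val_param, hk]
    exact ZFSet.isOrdinal_toZFSet _
  refine ⟨_, isTransitive_termModel wf, modelEmb wf hs,
    ⟨ZFSet.isOrdinal_toZFSet _, ?_, fun α _ hα => ?_⟩, ?_, ?_⟩
  · rw [hjκ, ← mostowski_ord_index wf hs hH hW hi]
    exact hmem i
  · obtain ⟨γ, h1, rfl⟩ := Ordinal.mem_toZFSet_iff.1 hα
    obtain ⟨ξ, hξ⟩ : ∃ ξ, s ξ = ⟨γ.toZFSet, hM _ hκ hα⟩ := s.surjective _
    have h2 := modelEmb_apply wf hs ξ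
    rw [hξ] at h2
    rw [h2]
    refine Eq.trans ?_ (mostowski_ord_param wf hs hH hW hi ⟨γ, h1⟩)
    rw [mostowski_eq_iff_coe wf hs]
    refine .of_forall fun π => ?_
    rw [hs.coe_ord, HullTerm.val_param, HullTerm.val_param, hξ]
  · rw [hjκ, ← (ZFSet.isOrdinal_toZFSet θ).rank_lt_iff_mem hord, Ordinal.rank_toZFSet]
    exact (le_rank_mostowski_ord_index wf hs hW ⟨θ, by simp⟩).trans_lt
      (ZFSet.rank_lt_of_mem (hmem _))
  · have hlM (γ) (hγ : γ < κ) : l γ ∈ M := by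
      have h1 := hM _ hLM (hL γ hγ)
      rw [ZFSet.pair] at h1
      exact hM _ (hM _ h1 (show {γ.toZFSet, l γ} ∈ _ by simp)) (by simp)
    have hguess' : ∀ᶠ π in (W : Filter (Set.Iio (θ + 1) → Set.Iio κ)), l (π i) = P (π i) a :=
      (hW {.inr i} (by simp)).mono fun π hπ => hguess _ (hπ.2.1 i rfl)
    have hPM : ∀ᶠ π in (W : Filter (Set.Iio (θ + 1) → Set.Iio κ)), P (π i) a ∈ M :=
      hguess'.mono fun π hπ => hπ ▸ hlM _ (π i).2
    let g : HullTerm κ (θ + 1) := .func HullFunc.graph ![.var (.inr i)]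
    have hg (π) : (s (g.val π) : ZFSet.{u}) = ZFSet.pair (π i).1.toZFSet (l (π i).1) :=
      hs.graph fun j => HullTerm.val ((![.var (.inr i)] : Fin 1 → HullTerm κ (θ + 1)) j) π
    rw [hjL, ← mostowski_proj wf hs hH hW hi hM hP a hPM,
      ← mostowski_ord_index wf hs hH hW hi, ← mostowski_pair wf hs hM (t := g),
      mostowski_mem_iff_coe wf hs]
    · refine .of_forall fun π => ?_
      rw [hg, HullTerm.val_param, hf]
      exact hL _ (π i).2
    · filter_upwards [hguess', hPM] with π h1 h2
      rw [hg, hs.coe_ord, hs.coe_proj (.var (.inr i)) (.var (.inl a)) π h2, h1]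
      rfl

/-- The Laver function below `κ` as a set of pairs. -/
noncomputable def laverSet (κ : Ordinal.{u}) : ZFSet.{u} :=
  ZFSet.range fun γ : Set.Iio κ => ZFSet.pair γ.1.toZFSet (laver γ.1)

theorem mem_laverSet {κ : Ordinal.{u}} {p : ZFSet.{u}} :
    p ∈ laverSet κ ↔ ∃ γ < κ, ZFSet.pair γ.toZFSet (laver γ) = p := by
  simp [laverSet, ZFSet.mem_range]

theorem NormalOn.isPFun_laverSet {κ : Ordinal.{u}} {U : Ultrafilter Ordinal.{u}}
    (hU : NormalOn κ U) : IsPFun κ.toZFSet (laverSet κ) := by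
  constructor
  · intro p hp
    obtain ⟨γ, h1, rfl⟩ := mem_laverSet.1 hp
    refine ⟨_, _, Ordinal.toZFSet_mem_toZFSet_iff.2 h1, ?_, rfl⟩
    rw [MemV, Ordinal.rank_toZFSet]
    exact rank_laver_lt hU h1
  · intro γ A B hA hB
    obtain ⟨α, -, h1⟩ := mem_laverSet.1 hA
    obtain ⟨β, -, h2⟩ := mem_laverSet.1 hB
    obtain ⟨h3, rfl⟩ := ZFSet.pair_inj.1 h1
    obtain ⟨h4, rfl⟩ := ZFSet.pair_inj.1 h2
    rw [Ordinal.toZFSet_injective (h3.trans h4.symm)]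

theorem exists_equiv_apply_eq {κ : Ordinal.{u}} {M A : ZFSet.{u}}
    (h : Cardinal.mk M.toSet = Cardinal.mk κ.toZFSet.toSet) (a : Set.Iio κ) (hA : A ∈ M) :
    ∃ s : Set.Iio κ ≃ M.toSet, (s a : ZFSet.{u}) = A := by
  classical
  have h1 : κ.toZFSet.toSet = Ordinal.toZFSet '' Set.Iio κ := Ordinal.coe_toZFSet
  rw [h1, Cardinal.mk_image_eq Ordinal.toZFSet_injective] at h
  obtain ⟨s⟩ := Cardinal.eq.1 h.symm
  exact ⟨(Equiv.swap a (s.symm ⟨A, hA⟩)).trans s, by simp⟩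

theorem NormalOn.countablyUnbounded {κ : Ordinal.{u}} {U : Ultrafilter Ordinal.{u}}
    (hU : NormalOn κ U) {H : Set Ordinal.{u}} (hH : H ⊆ Set.Iio κ)
    (h : ∀ ξ < κ, ∃ η ∈ H, ξ < η) : CountablyUnbounded κ H := by
  intro S hS
  have := hS.to_subtype
  obtain ⟨δ, h1, h2⟩ := hU.exists_bound_countable (ι := S) (fun x => x.1.1) (fun x => x.1.2)
  obtain ⟨η, h3, h4⟩ := h δ h1
  exact ⟨⟨η, hH h3⟩, h3, fun x hx => (h2 ⟨x, hx⟩).trans h4⟩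

theorem NormalOn.ldunfFun_laverSet {κ : Ordinal.{u}} {U : Ultrafilter Ordinal.{u}}
    (hU : NormalOn κ U) : LDunfFun κ.toZFSet (laverSet κ) := by
  refine ⟨hU.isPFun_laverSet, fun θ A M hθ _ hM hcard _ hκM hLM hAM => ?_⟩
  obtain ⟨θ, rfl⟩ : ∃ o : Ordinal.{u}, o.toZFSet = θ := ⟨_, hθ.toZFSet_rank_eq⟩
  let a : Set.Iio κ := ⟨0, omega0_pos.trans hU.omega_lt⟩
  have hne : Nonempty (Set.Iio κ) := ⟨a⟩
  obtain ⟨s, rfl⟩ := exists_equiv_apply_eq hcard a hAM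
  let R₀ : ℕ → List Ordinal.{u} → Prop := fun _ l => memCode s (listVal κ l 0) (listVal κ l 1)
  have hwf (h : Ordinal.{u}) : WellFounded (codedRel R₀ h) :=
    Subrelation.wf (fun {x y} hxy => hxy.2.2)
      (InvImage.wf (fun ξ => (s (listVal κ [ξ] 0) : ZFSet.{u})) ZFSet.mem_wf)
  have hR₀ (ξ η : Set.Iio κ) : R₀ 0 [ξ.1, η.1] ↔ memCode s ξ η := by
    have h1 : listVal κ [ξ.1, η.1] 0 = ξ := by simp [listVal, Set.mem_Iio.1 ξ.2]
    have h2 : listVal κ [ξ.1, η.1] 1 = η := by simp [listVal, Set.mem_Iio.1 η.2]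
    simp only [R₀, h1, h2]
  let P (h ξ : Set.Iio κ) : ZFSet.{u} := collapse h.1 (codedRel R₀ h.1) ξ.1
  have hP (h ξ z) (hξ : ξ < h) : z ∈ P h ξ ↔ ∃ η < h, memCode s η ξ ∧ P h η = z := by
    rw [mem_collapse (hwf _)]
    constructor
    · rintro ⟨η, h1, h2, h3⟩
      exact ⟨⟨η, h1.trans h.2⟩, h1, (hR₀ ⟨η, h1.trans h.2⟩ ξ).1 h2.2.2, h3⟩
    · rintro ⟨η, h1, h2, h3⟩
      exact ⟨η.1, h1, ⟨h1, hξ, (hR₀ η ξ).2 h2⟩, h3⟩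
  obtain ⟨_, hs⟩ := exists_hullSpec hM s P laver
    (fun ξ => hM _ hκM (Ordinal.toZFSet_mem_toZFSet_iff.2 ξ.2))
    (fun ξ => hM _ hLM (mem_laverSet.2 ⟨_, ξ.2, rfl⟩))
  have : Nonempty Atom := ⟨true, .var 0, .var 0⟩
  obtain ⟨enum, henum⟩ := exists_surjective_nat Atom
  let R : ℕ → List Ordinal.{u} → Prop
    | 0 => R₀ 0
    | n + 1 => atomRel (memCode s) (enum n)
  obtain ⟨H, h1, h2, h3, h4⟩ := hU.laver_guesses R (hwf κ)
  refine hs.exists_unfolding θ hM (hU.countablyUnbounded h1 h2) (fun b => ?_) hP hκM hLM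
    (fun γ hγ => mem_laverSet.2 ⟨γ, hγ, rfl⟩) a fun h hh => h4 h hh
  obtain ⟨n, rfl⟩ := henum b
  exact fun _ => h3 (n + 1)

/-- The atomic formula stating membership. -/
def memFormula {α : Type*} {n : ℕ} (x y : α ⊕ Fin n) : SetLang.BoundedFormula α n :=
  Language.Relations.boundedFormula₂ (L := SetLang) memRel.mem (.var x) (.var y)

theorem realize_memFormula {α : Type*} {n : ℕ} (x y : α ⊕ Fin n) (X : Set ZFSet.{u}) (v : α → X)
    (xs : Fin n → X) : (memFormula x y).Realize v xs ↔
      ((Sum.elim v xs x : X) : ZFSet.{u}) ∈ ((Sum.elim v xs y : X) : ZFSet.{u}) :=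
  Iff.rfl

/-- The atomic formula stating equality. -/
def eqFormula {α : Type*} {n : ℕ} (x y : α ⊕ Fin n) : SetLang.BoundedFormula α n :=
  .equal (.var x) (.var y)

theorem realize_eqFormula {α : Type*} {n : ℕ} (x y : α ⊕ Fin n) (X : Set ZFSet.{u}) (v : α → X)
    (xs : Fin n → X) : (eqFormula x y).Realize v xs ↔
      ((Sum.elim v xs x : X) : ZFSet.{u}) = ((Sum.elim v xs y : X) : ZFSet.{u}) :=
  Subtype.ext_iff

theorem mem_V (x : ZFSet.{u}) : x ∈ V := trivial

namespace ClassEmb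

variable {M : Set ZFSet.{u}} (e : ClassEmb V M)

theorem j_imp (hM : TransClass M) {a b c : ZFSet.{u}} (h : ∀ z ∈ a, z ∈ b → z ∈ c) :
    ∀ z ∈ e.j a, z ∈ e.j b → z ∈ e.j c := by
  have h' := e.elem (n := 3) (.all (.imp (memFormula (.inr 0) (.inl 0))
    (.imp (memFormula (.inr 0) (.inl 1)) (memFormula (.inr 0) (.inl 2)))))
    ![a, b, c] (fun _ => trivial)
  simp [Language.Formula.Realize, Fin.snoc, mem_V, realize_memFormula] at h'
  exact fun z hz => h'.1 h z (hM _ (e.maps a trivial) _ hz) hz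

theorem j_imp_or (hM : TransClass M) {a b c : ZFSet.{u}} (h : ∀ z ∈ a, z ∈ b ∨ z ∈ c) :
    ∀ z ∈ e.j a, z ∈ e.j b ∨ z ∈ e.j c := by
  have h' := e.elem (n := 3) (.all (.imp (memFormula (.inr 0) (.inl 0))
    (memFormula (.inr 0) (.inl 1) ⊔ memFormula (.inr 0) (.inl 2))))
    ![a, b, c] (fun _ => trivial)
  simp [Language.Formula.Realize, Fin.snoc, mem_V, realize_memFormula] at h'
  exact fun z hz => h'.1 h z (hM _ (e.maps a trivial) _ hz) hz

theorem j_disjoint (hM : TransClass M) {a b : ZFSet.{u}} (h : ∀ z ∈ a, z ∉ b) :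
    ∀ z ∈ e.j a, z ∉ e.j b := by
  have h' := e.elem (n := 2) (.all (.imp (memFormula (.inr 0) (.inl 0))
    (memFormula (.inr 0) (.inl 1)).not)) ![a, b] (fun _ => trivial)
  simp [Language.Formula.Realize, Fin.snoc, mem_V, realize_memFormula] at h'
  exact fun z hz => h'.1 h z (hM _ (e.maps a trivial) _ hz) hz

theorem j_imp_of_mem (hM : TransClass M) {a c d : ZFSet.{u}} (h : ∀ z ∈ a, c ∈ z → z ∈ d) :
    ∀ z ∈ e.j a, e.j c ∈ z → z ∈ e.j d := by
  have h' := e.elem (n := 3) (.all (.imp (memFormula (.inr 0) (.inl 0))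
    (.imp (memFormula (.inl 1) (.inr 0)) (memFormula (.inr 0) (.inl 2)))))
    ![a, c, d] (fun _ => trivial)
  simp [Language.Formula.Realize, Fin.snoc, mem_V, realize_memFormula] at h'
  exact fun z hz => h'.1 h z (hM _ (e.maps a trivial) _ hz) hz

/-- A set of unordered pairs that is regressive on `a` is mapped to one that is regressive on
`j a`. -/
theorem j_regressive (hM : TransClass M) {a g : ZFSet.{u}}
    (h : ∀ x ∈ a, ∃ ξ ∈ x, ∃ p ∈ g, ξ ∈ p ∧ x ∈ p) :
    ∀ x ∈ e.j a, ∃ ξ ∈ x, ∃ p ∈ e.j g, ξ ∈ p ∧ x ∈ p := by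
  have h' := e.elem (n := 2) (.all (.imp (memFormula (.inr 0) (.inl 0))
    (.ex (memFormula (.inr 1) (.inr 0) ⊓ (.ex (memFormula (.inr 2) (.inl 1) ⊓
      (memFormula (.inr 1) (.inr 2) ⊓ memFormula (.inr 0) (.inr 2))))))))
    ![a, g] (fun _ => trivial)
  simp [Language.Formula.Realize, Fin.snoc, mem_V, realize_memFormula] at h'
  intro x hx
  obtain ⟨ξ, h1, -, p, h2, h3, -, h4⟩ := h'.1 h x (hM _ (e.maps a trivial) _ hx) hx
  exact ⟨ξ, h1, p, h2, h3, h4⟩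

theorem j_fiber (hM : TransClass M) {a g c d : ZFSet.{u}}
    (h : ∀ x ∈ a, ∀ p ∈ g, c ∈ p → x ∈ p → c ∈ x → x ∈ d) :
    ∀ x ∈ e.j a, ∀ p ∈ e.j g, e.j c ∈ p → x ∈ p → e.j c ∈ x → x ∈ e.j d := by
  have h' := e.elem (n := 4) (.all (.imp (memFormula (.inr 0) (.inl 0))
    (.all (.imp (memFormula (.inr 1) (.inl 1)) (.imp (memFormula (.inl 2) (.inr 1))
      (.imp (memFormula (.inr 0) (.inr 1)) (.imp (memFormula (.inl 2) (.inr 0))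
        (memFormula (.inr 0) (.inl 3)))))))))
    ![a, g, c, d] (fun _ => trivial)
  simp [Language.Formula.Realize, Fin.snoc, mem_V, realize_memFormula] at h'
  exact fun x hx p hp => h'.1 h x (hM _ (e.maps a trivial) _ hx) hx p
    (hM _ (e.maps g trivial) _ hp) hp

theorem j_max (hM : TransClass M) {a y : ZFSet.{u}} (h : ∀ z ∈ a, z ∈ y ∨ z = y) :
    ∀ z ∈ e.j a, z ∈ e.j y ∨ z = e.j y := by
  have h' := e.elem (n := 2) (.all (.imp (memFormula (.inr 0) (.inl 0))
    (memFormula (.inr 0) (.inl 1) ⊔ eqFormula (.inr 0) (.inl 1)))) ![a, y] (fun _ => trivial)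
  simp [Language.Formula.Realize, Fin.snoc, mem_V, realize_memFormula, realize_eqFormula] at h'
  exact fun z hz => h'.1 h z (hM _ (e.maps a trivial) _ hz) hz

theorem j_exists_max (hM : TransClass M) {a : ZFSet.{u}}
    (h : ∀ x ∈ a, ∀ w ∈ x, ∃ y ∈ x, ∀ z ∈ x, z ∈ y ∨ z = y) :
    ∀ x ∈ e.j a, ∀ w ∈ x, ∃ y ∈ x, ∀ z ∈ x, z ∈ y ∨ z = y := by
  have h' := e.elem (n := 1) (.all (.imp (memFormula (.inr 0) (.inl 0))
    (.all (.imp (memFormula (.inr 1) (.inr 0)) (.ex (memFormula (.inr 2) (.inr 0) ⊓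
      (.all (.imp (memFormula (.inr 3) (.inr 0))
        (memFormula (.inr 3) (.inr 2) ⊔ eqFormula (.inr 3) (.inr 2))))))))))
    ![a] (fun _ => trivial)
  simp [Language.Formula.Realize, Fin.snoc, mem_V, realize_memFormula, realize_eqFormula] at h'
  intro x hx w hw
  have hxM := hM _ (e.maps a trivial) _ hx
  obtain ⟨y, h1, -, h2⟩ := h'.1 h x hxM hx w (hM _ hxM _ hw) hw
  exact ⟨y, h1, fun z hz => h2 z (hM _ hxM _ hz) hz⟩

end ClassEmb

/-- The subset of the von Neumann ordinal `κ` consisting of the elements of `X`. -/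
noncomputable def ordSet (κ : Ordinal.{u}) (X : Set Ordinal.{u}) : ZFSet.{u} :=
  ZFSet.sep (fun z => z.rank ∈ X) κ.toZFSet

theorem mem_ordSet {κ : Ordinal.{u}} {X : Set Ordinal.{u}} {z : ZFSet.{u}} :
    z ∈ ordSet κ X ↔ ∃ γ < κ, γ ∈ X ∧ γ.toZFSet = z := by
  rw [ordSet, ZFSet.mem_sep, Ordinal.mem_toZFSet_iff]
  constructor
  · rintro ⟨⟨γ, h1, rfl⟩, h2⟩
    exact ⟨γ, h1, by rwa [Ordinal.rank_toZFSet] at h2, rfl⟩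
  · rintro ⟨γ, h1, h2, rfl⟩
    exact ⟨⟨γ, h1, rfl⟩, by rwa [Ordinal.rank_toZFSet]⟩

theorem toZFSet_mem_ordSet {κ γ : Ordinal.{u}} {X : Set Ordinal.{u}} :
    γ.toZFSet ∈ ordSet κ X ↔ γ < κ ∧ γ ∈ X := by
  simp [ordSet, Ordinal.rank_toZFSet, Ordinal.toZFSet_mem_toZFSet_iff]

namespace MeasEmb

variable {κ : Ordinal.{u}} (E : MeasEmb κ.toZFSet)

theorem j_toZFSet {ξ : Ordinal.{u}} (h : ξ < κ) : E.e.j ξ.toZFSet = ξ.toZFSet :=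
  E.crit.2.2 _ (ZFSet.isOrdinal_toZFSet _) (Ordinal.toZFSet_mem_toZFSet_iff.2 h)

/-- The ultrafilter derived from an embedding with critical point `κ`. -/
noncomputable def ultrafilter : Ultrafilter Ordinal.{u} :=
  .ofComplNotMemIff
    { sets := {X | κ.toZFSet ∈ E.e.j (ordSet κ X)}
      univ_sets := E.e.j_imp E.trans (a := κ.toZFSet) (b := κ.toZFSet) (fun z hz _ => by
        obtain ⟨γ, h, rfl⟩ := Ordinal.mem_toZFSet_iff.1 hz
        exact toZFSet_mem_ordSet.2 ⟨h, trivial⟩) _ E.crit.2.1 E.crit.2.1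
      sets_of_superset := fun {X Y} hX hXY => by
        refine E.e.j_imp E.trans (a := ordSet κ X) (b := ordSet κ X) (fun z hz _ => ?_)
          κ.toZFSet hX hX
        obtain ⟨γ, h, h', rfl⟩ := mem_ordSet.1 hz
        exact toZFSet_mem_ordSet.2 ⟨h, hXY h'⟩
      inter_sets := fun {X Y} hX hY => by
        refine E.e.j_imp E.trans (a := ordSet κ X) (b := ordSet κ Y) (fun z hz hz' => ?_)
          κ.toZFSet hX hY
        obtain ⟨γ, h, h', rfl⟩ := mem_ordSet.1 hz
        exact toZFSet_mem_ordSet.2 ⟨h, h', (toZFSet_mem_ordSet.1 hz').2⟩ } fun X => by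
    refine ⟨fun h => ?_, fun h h' => ?_⟩
    · refine (E.e.j_imp_or E.trans (a := κ.toZFSet) (fun z hz => ?_) _ E.crit.2.1).resolve_right h
      obtain ⟨γ, h, rfl⟩ := Ordinal.mem_toZFSet_iff.1 hz
      by_cases h' : γ ∈ X
      · exact .inl (toZFSet_mem_ordSet.2 ⟨h, h'⟩)
      · exact .inr (toZFSet_mem_ordSet.2 ⟨h, h'⟩)
    · refine E.e.j_disjoint E.trans (fun z hz hz' => ?_) κ.toZFSet h h'
      obtain ⟨γ, -, h, rfl⟩ := mem_ordSet.1 hz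
      exact (toZFSet_mem_ordSet.1 hz').2 h

theorem eventually_ultrafilter {p : Ordinal.{u} → Prop} :
    (∀ᶠ γ in (E.ultrafilter : Filter Ordinal.{u}), p γ) ↔ κ.toZFSet ∈ E.e.j (ordSet κ {γ | p γ}) :=
  Iff.rfl

theorem omega_lt (E : MeasEmb κ.toZFSet) : ω < κ := by
  by_contra! hκ
  have hmax (x : ZFSet.{u}) (hx : x ∈ κ.toZFSet) (w : ZFSet.{u}) (hw : w ∈ x) :
      ∃ y ∈ x, ∀ z ∈ x, z ∈ y ∨ z = y := by
    obtain ⟨γ, h, rfl⟩ := Ordinal.mem_toZFSet_iff.1 hx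
    obtain ⟨n, rfl⟩ := Ordinal.lt_omega0.1 (h.trans_le hκ)
    cases n with
    | zero => simp at hw
    | succ n =>
      rw [Nat.cast_add_one, Ordinal.toZFSet_add_one]
      refine ⟨(n : Ordinal.{u}).toZFSet, by simp, fun z hz => ?_⟩
      exact (ZFSet.mem_insert_iff.1 hz).symm
  have hne : ∃ w, w ∈ κ.toZFSet := by
    by_contra! h0
    exact E.e.j_disjoint E.trans (b := ∅) (fun z hz => absurd hz (h0 z)) _ E.crit.2.1
      (E.e.j_imp E.trans (b := κ.toZFSet) (fun z hz => absurd hz (h0 z)) _ E.crit.2.1 E.crit.2.1)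
  obtain ⟨w, hw⟩ := hne
  obtain ⟨y, hy, hy'⟩ := E.e.j_exists_max E.trans hmax _ E.crit.2.1 w hw
  obtain ⟨η, hη, rfl⟩ := Ordinal.mem_toZFSet_iff.1 hy
  have := E.e.j_max E.trans hy' _ E.crit.2.1
  rw [E.j_toZFSet hη] at this
  obtain h | h := this
  · exact ZFSet.mem_asymm h hy
  · exact ZFSet.mem_irrefl _ (h ▸ hy)

theorem normalOn_ultrafilter : NormalOn κ E.ultrafilter where
  lt := E.eventually_ultrafilter.2 <|
    E.e.j_imp E.trans (a := κ.toZFSet) (b := κ.toZFSet) (fun z hz _ => by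
      obtain ⟨γ, h, rfl⟩ := Ordinal.mem_toZFSet_iff.1 hz
      exact toZFSet_mem_ordSet.2 ⟨h, h⟩) _ E.crit.2.1 E.crit.2.1
  gt ξ hξ := E.eventually_ultrafilter.2 <|
    E.e.j_imp_of_mem E.trans (c := ξ.toZFSet) (fun z hz hz' => by
      obtain ⟨γ, h, rfl⟩ := Ordinal.mem_toZFSet_iff.1 hz
      exact toZFSet_mem_ordSet.2 ⟨h, Ordinal.toZFSet_mem_toZFSet_iff.1 hz'⟩) _ E.crit.2.1
      (by rwa [E.j_toZFSet hξ, Ordinal.toZFSet_mem_toZFSet_iff])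
  press f hf := by
    have hmem {p : ZFSet.{u}} :
        p ∈ ZFSet.range (fun γ : {γ : Set.Iio κ // f γ.1 < γ.1} =>
          ({(f γ.1.1).toZFSet, γ.1.1.toZFSet} : ZFSet.{u})) ↔
          ∃ γ < κ, f γ < γ ∧ {(f γ).toZFSet, γ.toZFSet} = p := by
      simp [and_left_comm]
    rw [eventually_ultrafilter] at hf
    obtain ⟨ξ, hξ, p, hp, hξp, hκp⟩ := E.e.j_regressive E.trans (fun x hx => by
      obtain ⟨γ, h, h', rfl⟩ := mem_ordSet.1 hx
      exact ⟨(f γ).toZFSet, Ordinal.toZFSet_mem_toZFSet_iff.2 h', _, hmem.2 ⟨γ, h, h', rfl⟩,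
        by simp, by simp⟩) _ hf
    obtain ⟨ξ, hξκ, rfl⟩ := Ordinal.mem_toZFSet_iff.1 hξ
    refine ⟨ξ, E.eventually_ultrafilter.2 <| E.e.j_fiber E.trans (c := ξ.toZFSet)
      (fun x hx p hp hξp hxp hξx => ?_) _ hf p hp ?_ hκp ?_⟩
    · obtain ⟨γ, h, h', rfl⟩ := mem_ordSet.1 hx
      obtain ⟨δ, -, h'', rfl⟩ := hmem.1 hp
      rw [Ordinal.toZFSet_mem_toZFSet_iff] at hξx
      simp only [ZFSet.mem_pair, Ordinal.toZFSet_injective.eq_iff] at hξp hxp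
      refine toZFSet_mem_ordSet.2 ⟨h, ?_⟩
      rcases hξp with rfl | rfl <;> rcases hxp with rfl | rfl
      · exact absurd hξx (lt_irrefl _)
      · rfl
      · exact absurd hξx h''.asymm
      · exact absurd hξx (lt_irrefl _)
    · rwa [E.j_toZFSet hξκ]
    · rwa [E.j_toZFSet hξκ]
  omega_lt := E.omega_lt

end MeasEmb

end

end LaverDiamond

/-- If `κ` is a measurable cardinal, then `LD^unf_κ` holds. -/
theorem LDunf_of_measurable (κ : ZFSet.{u}) (h : MeasurableCard κ) :
    LDunf κ := by
  obtain ⟨E⟩ := h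
  obtain ⟨κ, rfl⟩ := ZFSet.isOrdinal_iff_mem_range_toZFSet.1 E.crit.1
  exact ⟨laverSet κ, E.normalOn_ultrafilter.ldunfFun_laverSet⟩
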